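/- arXiv:1811.08733 — 2 statements merged into one kernel-verified Lean document; each statement's English description precedes it below -/
import Mathlib

section
/- (You's theorem, as the special case c_1 = ⋯ = c_{2n} = 0.) For every extended strict partition λ_1 > λ_2 > ⋯ > λ_{2n} ≥ 0, the polynomial Pf( χ_{λ_i,λ_j}(t̃, t̃) )_{1≤i,j≤2n} (which is, up to normalization, the Schur Q-function attached to λ) satisfies the BKP bilinear identity. -/
/- ## Setup: the ring `B = ℂ[t₁,t₃,t₅,…]`, elementary Schur polynomials,
   vertex-operator coefficients, and the BKP bilinear identity. -/

noncomputable section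

open MvPolynomial

/-- The polynomial ring `B = ℂ[t₁,t₃,t₅,…]`; variable `i` represents `t_{2i+1}`. -/
abbrev BRing : Type := MvPolynomial ℕ ℂ

/-- The universal elementary Schur polynomials `s_n`, defined by
`exp (∑_{j≥1} t_j z^j) = ∑_{n≥0} s_n(t) z^n`; here the variable `j` (for `j ≥ 1`)
represents `t_j`.  They satisfy `s_0 = 1` and `(n+1) s_{n+1} = ∑_{j=1}^{n+1} j t_j s_{n+1-j}`. -/
def schurPoly : ℕ → MvPolynomial ℕ ℂ
  | 0 => 1
  | n + 1 =>
      ((n + 1 : ℂ))⁻¹ •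
        ∑ j ∈ Finset.range (n + 1),
          ((j + 1 : ℂ)) • (MvPolynomial.X (j + 1) * schurPoly (n - j))
  termination_by n => n
  decreasing_by omega

/-- `s_n(c)` for a complex sequence `c = (c_1, c_2, …)` (the entry `c 0` is ignored). -/
def sC (n : ℕ) (c : ℕ → ℂ) : ℂ := MvPolynomial.eval c (schurPoly n)

/-- `s_n` evaluated on a sequence of elements of `B`. -/
def sB (n : ℕ) (c : ℕ → BRing) : BRing := MvPolynomial.aeval c (schurPoly n)

/-- The sequence `t̃ = (t₁, 0, t₃, 0, t₅, 0, …)` of elements of `B`. -/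
def tTilde : ℕ → BRing := fun j => if j % 2 = 1 then MvPolynomial.X ((j - 1) / 2) else 0

/-- The sequence `t̃ + c` for a constant sequence `c`. -/
def tShift (c : ℕ → ℂ) : ℕ → BRing := fun j => tTilde j + MvPolynomial.C (c j)

/-- `s̃_m = s_m(t̃) ∈ B` for `m ≥ 0`, and `0` for `m < 0`; these are the coefficients of
`exp (∑_{j>0 odd} t_j z^j)`. -/
def sTildeZ (m : ℤ) : BRing :=
  if 0 ≤ m then MvPolynomial.aeval tTilde (schurPoly m.toNat) else 0

/-- `s_m(-t̃) ∈ B` for `m ≥ 0`, and `0` for `m < 0`; the coefficients of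
`exp (-∑_{j>0 odd} t_j z^j)`. -/
def sTildeNegZ (m : ℤ) : BRing :=
  if 0 ≤ m then MvPolynomial.aeval (fun j => -(tTilde j)) (schurPoly m.toNat) else 0

/-- `p(t₁ - 2w, t₃ - (2/3)w³, t₅ - (2/5)w⁵, …)` as a polynomial in `w` (which stands for
`z⁻¹`) over `B`: this is `exp (-2∑_{j>0 odd} (1/j) ∂/∂t_j z^{-j}) p` by Taylor's formula. -/
def shiftMinus (p : BRing) : Polynomial BRing :=
  MvPolynomial.aeval
    (fun i => Polynomial.C (MvPolynomial.X i) -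
      Polynomial.C (MvPolynomial.C ((2 : ℂ) / ((2 * i + 1 : ℕ) : ℂ))) *
        Polynomial.X ^ (2 * i + 1)) p

/-- `p(t₁ + 2w, t₃ + (2/3)w³, …)`, i.e. `exp (2∑_{j>0 odd} (1/j) ∂/∂t_j z^{-j}) p`. -/
def shiftPlus (p : BRing) : Polynomial BRing :=
  MvPolynomial.aeval
    (fun i => Polynomial.C (MvPolynomial.X i) +
      Polynomial.C (MvPolynomial.C ((2 : ℂ) / ((2 * i + 1 : ℕ) : ℂ))) *
        Polynomial.X ^ (2 * i + 1)) p

/-- The coefficient of `z^m` in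
`exp (∑_{j>0 odd} t_j z^j) exp (-2∑_{j>0 odd} (1/j)(∂/∂t_j) z^{-j}) τ`. -/
def leftCoeff (τ : BRing) (m : ℤ) : BRing :=
  ∑ᶠ k : ℕ, sTildeZ (m + k) * (shiftMinus τ).coeff k

/-- The coefficient of `z^m` in
`exp (-∑_{j>0 odd} t_j z^j) exp (2∑_{j>0 odd} (1/j)(∂/∂t_j) z^{-j}) τ`. -/
def rightCoeff (τ : BRing) (m : ℤ) : BRing :=
  ∑ᶠ k : ℕ, sTildeNegZ (m + k) * (shiftPlus τ).coeff k

/-- `ℂ[t₁,t₃,…] ⊗ ℂ[t'₁,t'₃,…]`, realized as polynomials in two families of variables. -/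
abbrev BRing2 : Type := MvPolynomial (ℕ ⊕ ℕ) ℂ

/-- The embedding `p(t) ↦ p(t) ∈ ℂ[t] ⊗ ℂ[t']` on the first factor. -/
def inL : BRing →+* BRing2 := (MvPolynomial.rename Sum.inl).toRingHom

/-- The embedding `p(t') ↦ p(t') ∈ ℂ[t] ⊗ ℂ[t']` on the second factor. -/
def inR : BRing →+* BRing2 := (MvPolynomial.rename Sum.inr).toRingHom

/-- The BKP bilinear identity on `τ ∈ ℂ[t₁,t₃,t₅,…]`: the coefficient of `z⁰` in
`(exp(∑ t_j z^j) exp(-2∑ (1/j)∂_{t_j} z^{-j}) τ)(t) ·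
 (exp(-∑ t'_j z^j) exp(2∑ (1/j)∂_{t'_j} z^{-j}) τ)(t')`
equals `τ(t) τ(t')` (all sums over odd `j > 0`; only finitely many summands below
are nonzero since `τ` is a polynomial). -/
def SatisfiesBKP (τ : BRing) : Prop :=
  ∑ᶠ m : ℤ, inL (leftCoeff τ m) * inR (rightCoeff τ (-m)) = inL τ * inR τ

/-- The MDKP bilinear identity on a pair `(τ₀, τ₁)`. -/
def SatisfiesMDKP (τ₀ τ₁ : BRing) : Prop :=
  ∑ᶠ m : ℤ, inL (leftCoeff τ₀ m) * inR (rightCoeff τ₁ (-m)) = inL τ₁ * inR τ₀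

/-- The condition on a permutation `σ` appearing in the definition of the Pfaffian:
`σ(2i-1) < σ(2i)` for all `i`, and `σ(1) < σ(3) < ⋯` (with 0-based indices here). -/
def pfaffianCond {m : ℕ} (σ : Equiv.Perm (Fin m)) : Prop :=
  (∀ i : Fin (m / 2),
      σ ⟨2 * i.val, by have := i.isLt; omega⟩ < σ ⟨2 * i.val + 1, by have := i.isLt; omega⟩) ∧
  (∀ i j : Fin (m / 2), i < j →
      σ ⟨2 * i.val, by have := i.isLt; omega⟩ < σ ⟨2 * j.val, by have := j.isLt; omega⟩)

open scoped Classical in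
/-- The Pfaffian `Pf(A) = ∑_σ sgn(σ) ∏_i a_{σ(2i-1),σ(2i)}` of a (skew-symmetric) matrix;
it is intended to be used for matrices of even size `m = 2n`. -/
def pfaffian {R : Type*} [CommRing R] {m : ℕ} (A : Matrix (Fin m) (Fin m) R) : R :=
  ∑ σ : Equiv.Perm (Fin m),
    if pfaffianCond σ then
      (Equiv.Perm.sign σ : ℤ) •
        ∏ i : Fin (m / 2),
          A (σ ⟨2 * i.val, by have := i.isLt; omega⟩)
            (σ ⟨2 * i.val + 1, by have := i.isLt; omega⟩)
    else 0

/-- The skew-symmetric matrix with `(i,j)`-entry `f i j` for `i < j`. -/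
def skewOf {R : Type*} [CommRing R] {m : ℕ} (f : Fin m → Fin m → R) :
    Matrix (Fin m) (Fin m) R :=
  Matrix.of fun i j => if i < j then f i j else if j < i then -f j i else 0

/-- `χ_{λ,μ}(c,c') = (1/2) s_λ(c) s_μ(c') + ∑_{ℓ=1}^{μ} (-1)^ℓ s_{λ+ℓ}(c) s_{μ-ℓ}(c')`,
for `λ > μ ≥ 0` and sequences `c, c'` of elements of `B`. -/
def chiB (l μ : ℕ) (c c' : ℕ → BRing) : BRing :=
  (2 : ℂ)⁻¹ • (sB l c * sB μ c') +
    ∑ ℓ ∈ Finset.Icc 1 μ, ((-1 : ℂ) ^ ℓ) • (sB (l + ℓ) c * sB (μ - ℓ) c')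

/-- The skew-symmetric matrix `( χ_{λ_i,λ_j}(t̃+c_i, t̃+c_j) )_{i,j}`. -/
def chiMatrix {m : ℕ} (lam : Fin m → ℕ) (c : Fin m → ℕ → ℂ) :
    Matrix (Fin m) (Fin m) BRing :=
  skewOf fun i j => chiB (lam i) (lam j) (tShift (c i)) (tShift (c j))

/-- `√2` as a complex number. -/
def sqrt2 : ℂ := (Real.sqrt 2 : ℂ)

/-- `ρ_{λ,μ}(c,c';b,b') = (s_λ(c)/√2 - b)(s_μ(c')/√2 + b')
  + ∑_{ℓ=1}^{μ} (-1)^ℓ s_{λ+ℓ}(c) s_{μ-ℓ}(c')` for `λ > μ ≥ 0`. -/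
def rhoB (l μ : ℕ) (c c' : ℕ → BRing) (b b' : ℂ) : BRing :=
  (sqrt2⁻¹ • sB l c - MvPolynomial.C b) * (sqrt2⁻¹ • sB μ c' + MvPolynomial.C b') +
    ∑ ℓ ∈ Finset.Icc 1 μ, ((-1 : ℂ) ^ ℓ) • (sB (l + ℓ) c * sB (μ - ℓ) c')

/-- `ρ_λ(c;b) = s_λ(c)/√2 + b`. -/
def rho1B (l : ℕ) (c : ℕ → BRing) (b : ℂ) : BRing :=
  sqrt2⁻¹ • sB l c + MvPolynomial.C b

/-- The `2n × 2n` skew-symmetric matrix `( ρ_{λ_i,λ_j}(t̃+c_i, t̃+c_j; b_i, b_j) )_{i,j}`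
(for an even number `m = 2n` of rows of `λ`). -/
def rhoMatrixEven {m : ℕ} (lam : Fin m → ℕ) (c : Fin m → ℕ → ℂ) (b : Fin m → ℂ) :
    Matrix (Fin m) (Fin m) BRing :=
  skewOf fun i j => rhoB (lam i) (lam j) (tShift (c i)) (tShift (c j)) (b i) (b j)

/-- For an odd number `m` of parts `λ_1 > ⋯ > λ_m ≥ 0`, the `(m+1) × (m+1)`
skew-symmetric matrix with rows/columns indexed by `0, 1, …, m`, whose `(0,j)`-entry is
`ρ_{λ_j}(t̃+c_j; b_j)` and whose `(i,j)`-entry for `1 ≤ i < j` is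
`ρ_{λ_i,λ_j}(t̃+c_i, t̃+c_j; b_i, b_j)`. -/
def rhoMatrixOdd {m : ℕ} (lam : Fin m → ℕ) (c : Fin m → ℕ → ℂ) (b : Fin m → ℂ) :
    Matrix (Fin (m + 1)) (Fin (m + 1)) BRing :=
  skewOf fun i j =>
    if i.val = 0 then
      if hj : j.val = 0 then 0
      else
        rho1B (lam ⟨j.val - 1, by have := j.isLt; omega⟩)
          (tShift (c ⟨j.val - 1, by have := j.isLt; omega⟩))
          (b ⟨j.val - 1, by have := j.isLt; omega⟩)
    else
      if hj : j.val = 0 then 0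
      else
        rhoB (lam ⟨i.val - 1, by have := i.isLt; omega⟩)
          (lam ⟨j.val - 1, by have := j.isLt; omega⟩)
          (tShift (c ⟨i.val - 1, by have := i.isLt; omega⟩))
          (tShift (c ⟨j.val - 1, by have := j.isLt; omega⟩))
          (b ⟨i.val - 1, by have := i.isLt; omega⟩)
          (b ⟨j.val - 1, by have := j.isLt; omega⟩)

/-- The DKP tau-function `ρ_λ(t̃; c_1,…,c_k; b_1,…,b_k)` attached to an extended strict
partition `λ` with `k` parts: a Pfaffian of size `k` if `k` is even, and of size `k+1`
(with an extra 0-th row built from the `ρ_{λ_j}`) if `k` is odd. -/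
def rhoTau {k : ℕ} (lam : Fin k → ℕ) (c : Fin k → ℕ → ℂ) (b : Fin k → ℂ) : BRing :=
  if k % 2 = 0 then pfaffian (rhoMatrixEven lam c b)
  else pfaffian (rhoMatrixOdd lam c b)

/-- The operators `φ̂_j` (`j ∈ ℤ`) on `B`, defined by the generating series
`∑_{j∈ℤ} φ̂_j z^{-j} = (1/√2) exp(∑_{k>0 odd} t_k z^k) exp(-∑_{k>0 odd} (2/k) ∂_{t_k} z^{-k})`. -/
def phiHat (j : ℤ) (p : BRing) : BRing :=
  sqrt2⁻¹ • ∑ᶠ k : ℕ, sTildeZ ((k : ℤ) - j) * (shiftMinus p).coeff k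

/-- `a : ℤ → ℂ` vanishes for all sufficiently negative indices. -/
def BddBelowSupport (a : ℤ → ℂ) : Prop := ∃ N : ℤ, ∀ j < N, a j = 0

/-- The operator `v = ∑_{j∈ℤ} a_j φ̂_j` on `B` (a finite sum on each polynomial,
when `a` has support bounded below). -/
def vOp (a : ℤ → ℂ) (p : BRing) : BRing := ∑ᶠ j : ℤ, a j • phiHat j p

/-- Evaluation at `t = 0`, `ev₀ : B → ℂ` (the vacuum expectation value). -/
def ev0 : BRing → ℂ := MvPolynomial.eval (fun _ => 0)

/-- The "`√2` times `φ̂_j`" vertex operator coefficients (without the `1/√2` factor),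
used for the type `D` construction. -/
def vertexB (j : ℤ) (p : BRing) : BRing :=
  ∑ᶠ k : ℕ, sTildeZ ((k : ℤ) - j) * (shiftMinus p).coeff k

/-- `B_D = ℂ[θ] ⊗ B` with `θ` a Grassmann variable: the pair `(p₀, p₁)` represents
`p₀ + θ p₁`. -/
abbrev BD : Type := BRing × BRing

/-- The operators `Φ̂_j` (`j ∈ ℤ`) on `B_D`, defined by
`∑_j Φ̂_j z^{-j} = (1/√2)(θ + ∂/∂θ) exp(∑ t_k z^k) exp(-∑ (2/k) ∂_{t_k} z^{-k})`. -/
def PhiHatD (j : ℤ) (p : BD) : BD :=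
  sqrt2⁻¹ • (vertexB j p.2, vertexB j p.1)

/-- `Ψ = (θ - ∂/∂θ)/√2` on `B_D`. -/
def PsiD (p : BD) : BD := sqrt2⁻¹ • (-p.2, p.1)

/-- The type `D` fermions `φ̂_a`, `a ∈ ½ + ℤ`, where the integer `m` encodes the
half-integer index `a = m + ½`:  `φ̂_{-i-½} = Φ̂_{-i}` and `φ̂_{i+½} = (-1)^i Φ̂_i`
for `i ≥ 1`, `φ̂_{-½} = (Φ̂_0 + Ψ)/√2`, `φ̂_{½} = (Φ̂_0 - Ψ)/√2`. -/
def phiD (m : ℤ) (p : BD) : BD :=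
  if m ≤ -2 then PhiHatD (m + 1) p
  else if m = -1 then sqrt2⁻¹ • (PhiHatD 0 p + PsiD p)
  else if m = 0 then sqrt2⁻¹ • (PhiHatD 0 p - PsiD p)
  else ((-1 : ℂ) ^ m) • PhiHatD m p

end
noncomputable section
open MvPolynomial
namespace QBKP

/-! Alternating sums over deletions of one list element. -/
def Dop {α R : Type*} [CommRing R] : (α → List α → R) → List α → R
  | _, [] => 0
  | φ, a :: L => φ a L - Dop (fun b M => φ b (a :: M)) L

section D
variable {α R S : Type*} [CommRing R] [CommRing S]

lemma Dop_congr (L : List α) : ∀ (φ ψ : α → List α → R),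
    (∀ a ∈ L, ∀ M : List α, M.length + 1 = L.length → φ a M = ψ a M) → Dop φ L = Dop ψ L := by
  induction L with
  | nil => intros; rfl
  | cons a L ih =>
    intro φ ψ h
    simp only [Dop]
    rw [h a (by simp) L (by simp)]
    congr 1
    apply ih
    intro b hb M hM
    exact h b (by simp [hb]) _ (by simp [hM])

lemma Dop_zero (L : List α) : Dop (fun (_ : α) (_ : List α) => (0 : R)) L = 0 := by
  induction L with
  | nil => rfl
  | cons a L ih => simp [Dop, ih]

lemma Dop_map (g : R →+ S) (L : List α) : ∀ (φ : α → List α → R),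
    g (Dop φ L) = Dop (fun a M => g (φ a M)) L := by
  induction L with
  | nil => intro φ; simp [Dop]
  | cons a L ih => intro φ; simp [Dop, ih]

lemma Dop_add (L : List α) : ∀ (φ ψ : α → List α → R),
    Dop (fun a M => φ a M + ψ a M) L = Dop φ L + Dop ψ L := by
  induction L with
  | nil => intros; simp [Dop]
  | cons a L ih => intro φ ψ; simp only [Dop]; rw [ih]; ring

lemma Dop_mul (c : R) (L : List α) (φ : α → List α → R) :
    Dop (fun a M => c * φ a M) L = c * Dop φ L :=
  (Dop_map (AddMonoidHom.mulLeft c) L φ).symm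

lemma Dop_neg (L : List α) (φ : α → List α → R) :
    Dop (fun a M => - φ a M) L = - Dop φ L := by
  have := Dop_mul (-1) L φ
  simpa using this

lemma Dop_sub (L : List α) (φ ψ : α → List α → R) :
    Dop (fun a M => φ a M - ψ a M) L = Dop φ L - Dop ψ L := by
  simp only [sub_eq_add_neg]
  rw [Dop_add, Dop_neg]

lemma Dop_swap (L : List α) : ∀ (φ : α → α → List α → R),
    Dop (fun a M => Dop (fun b N => φ a b N) M) L
      = - Dop (fun a M => Dop (fun b N => φ b a N) M) L := by
  induction L with
  | nil => intros; simp [Dop]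
  | cons a L ih =>
    intro φ
    simp only [Dop, Dop_sub]
    rw [ih (fun x y N => φ x y (a :: N))]
    ring

lemma Dop_ofFn (m : ℕ) : ∀ (g : Fin (m + 1) → α) (φ : α → List α → R),
    Dop φ (List.ofFn g) =
      ∑ k : Fin (m + 1), (-1) ^ (k : ℕ) * φ (g k) (List.ofFn fun i => g (k.succAbove i)) := by
  induction m with
  | zero => intro g φ; simp [Dop]
  | succ m ih =>
    intro g φ
    rw [List.ofFn_succ, Fin.sum_univ_succ]
    simp only [Dop]
    rw [ih, sub_eq_add_neg, ← Finset.sum_neg_distrib]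
    congr 1
    · simp
    · apply Finset.sum_congr rfl
      intro k _
      rw [List.ofFn_succ (n := m)]
      simp [pow_succ, Fin.succ_succAbove_succ]

lemma Dop_append [DecidableEq α] (x : α) (M : List α) : ∀ (φ : α → List α → R),
    (∀ a, a ≠ x → ∀ N, φ a N = 0) → x ∉ M →
    Dop φ (M ++ [x]) = (-1) ^ M.length * φ x M := by
  induction M with
  | nil => intro φ h hx; simp [Dop]
  | cons a M ih =>
    intro φ h hx
    simp only [List.mem_cons, not_or] at hx
    simp only [List.cons_append, Dop]
    rw [ih _ (fun b hb N => h b hb _) hx.2, h a (Ne.symm hx.1)]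
    simp [pow_succ]
end D

/-! Schur polynomials on odd times. -/
def sN (n : ℕ) : BRing := aeval tTilde (schurPoly n)

lemma aeval_schur_succ {A : Type*} [CommRing A] [Algebra ℂ A] (c : ℕ → A) (n : ℕ) :
    ((n : A) + 1) * aeval c (schurPoly (n + 1)) =
      ∑ j ∈ Finset.range (n + 1), ((j : A) + 1) * (c (j + 1) * aeval c (schurPoly (n - j))) := by
  rw [schurPoly]
  simp only [map_smul, map_sum, map_mul, aeval_X]
  have h1 : ((n : A) + 1) = algebraMap ℂ A ((n : ℂ) + 1) := by simp
  rw [h1, ← Algebra.smul_def, smul_smul, mul_inv_cancel₀ (by exact_mod_cast Nat.succ_ne_zero n),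
    one_smul]
  apply Finset.sum_congr rfl
  intro j _
  rw [Algebra.smul_def]
  simp

lemma aeval_schur_zero {A : Type*} [CommRing A] [Algebra ℂ A] (c : ℕ → A) :
    aeval c (schurPoly 0) = 1 := by rw [schurPoly]; simp

/-- generating series -/
def Eser {A : Type*} [CommRing A] [Algebra ℂ A] (c : ℕ → A) : PowerSeries A :=
  PowerSeries.mk fun n => aeval c (schurPoly n)

def Hser {A : Type*} [CommRing A] (c : ℕ → A) : PowerSeries A :=
  PowerSeries.mk fun j => ((j : A) + 1) * c (j + 1)

lemma Eser_deriv {A : Type*} [CommRing A] [Algebra ℂ A] (c : ℕ → A) :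
    PowerSeries.derivative A (Eser c) = Hser c * Eser c := by
  ext n
  rw [PowerSeries.coeff_derivative, PowerSeries.coeff_mul, Finset.Nat.sum_antidiagonal_eq_sum_range_succ_mk]
  simp only [Eser, Hser, PowerSeries.coeff_mk]
  rw [mul_comm, aeval_schur_succ]
  simp [mul_assoc]

lemma ode_unique {A : Type*} [CommRing A] [IsDomain A] [CharZero A] (M Y : PowerSeries A)
    (h : PowerSeries.derivative A Y = M * Y) (h0 : PowerSeries.coeff 0 Y = 0) : Y = 0 := by
  ext n
  induction n using Nat.strong_induction_on with
  | _ n ih =>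
    cases n with
    | zero => simpa using h0
    | succ n =>
      have := congrArg (PowerSeries.coeff n) h
      rw [PowerSeries.coeff_derivative, PowerSeries.coeff_mul, Finset.sum_eq_zero] at this
      · have h2 : (n : A) + 1 ≠ 0 := by exact_mod_cast Nat.succ_ne_zero n
        simpa [h2] using this
      · rintro ⟨i, j⟩ hij
        rw [Finset.HasAntidiagonal.mem_antidiagonal] at hij
        simp only at hij
        rw [ih j (by omega)]; simp

lemma sNeg (n : ℕ) : aeval (fun j => -(tTilde j)) (schurPoly n) = (-1) ^ n * sN n := by
  induction n using Nat.strong_induction_on with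
  | _ n ih =>
    cases n with
    | zero => rw [sN, aeval_schur_zero, aeval_schur_zero]; simp
    | succ n =>
      have h2 : (n : BRing) + 1 ≠ 0 := by exact_mod_cast Nat.succ_ne_zero n
      apply mul_left_cancel₀ h2
      rw [aeval_schur_succ, mul_left_comm, sN, aeval_schur_succ, Finset.mul_sum]
      apply Finset.sum_congr rfl
      intro j hj
      have hj' := Finset.mem_range.1 hj
      rw [ih _ (by omega), sN]
      by_cases hodd : j % 2 = 0
      · obtain ⟨k, rfl⟩ : ∃ k, n = j + k := ⟨n - j, by omega⟩
        obtain ⟨i, rfl⟩ : ∃ i, j = 2 * i := ⟨j / 2, by omega⟩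
        simp only [Nat.add_sub_cancel_left, pow_succ, pow_add, pow_mul]
        ring
      · have : tTilde (j + 1) = 0 := by
          unfold tTilde; rw [if_neg (by omega)]
        simp [this]

lemma neg_ser_mul : Eser tTilde * Eser (fun j => -(tTilde j)) = 1 := by
  rw [← sub_eq_zero]
  apply ode_unique 0
  · have : Hser (fun j => -(tTilde j)) = - Hser tTilde := by
      ext n; simp [Hser]
    rw [map_sub, Derivation.leibniz, Eser_deriv, Eser_deriv, this]
    simp only [smul_eq_mul, Derivation.map_one_eq_zero]
    ring
  · have e0 : ∀ c : ℕ → BRing, PowerSeries.coeff 0 (Eser c) = 1 := fun c => by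
      rw [Eser, PowerSeries.coeff_mk, aeval_schur_zero]
    simp only [PowerSeries.coeff_zero_eq_constantCoeff] at e0 ⊢
    rw [map_sub, map_mul, e0, e0, map_one]; simp

lemma sN_zero : sN 0 = 1 := aeval_schur_zero _

lemma sN_orth (n : ℕ) : ∑ j ∈ Finset.range (n + 1), (-1) ^ j * (sN j * sN (n - j))
    = if n = 0 then 1 else 0 := by
  have := congrArg (PowerSeries.coeff n) neg_ser_mul
  rw [mul_comm, PowerSeries.coeff_mul, Finset.Nat.sum_antidiagonal_eq_sum_range_succ_mk] at this
  simp only [Eser, PowerSeries.coeff_mk, sNeg, PowerSeries.coeff_one] at this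
  rw [← this]
  apply Finset.sum_congr rfl
  intro j _
  simp only [sN]; ring

/-! The shift operator. -/
def T : BRing →ₐ[ℂ] Polynomial BRing :=
  MvPolynomial.aeval
    (fun i => Polynomial.C (MvPolynomial.X i) -
      Polynomial.C (MvPolynomial.C ((2 : ℂ) / ((2 * i + 1 : ℕ) : ℂ))) *
        Polynomial.X ^ (2 * i + 1))

lemma T_eq (p : BRing) : shiftMinus p = T p := rfl

def u (n : ℕ) : Polynomial BRing := T (sN n)

lemma T_tTilde (j : ℕ) : ((j : Polynomial BRing) + 1) * T (tTilde (j + 1)) =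
    ((j : Polynomial BRing) + 1) * Polynomial.C (tTilde (j + 1)) -
      (if j % 2 = 0 then 2 * Polynomial.X ^ (j + 1) else 0) := by
  by_cases h : j % 2 = 0
  · obtain ⟨i, rfl⟩ : ∃ i, j = 2 * i := ⟨j / 2, by omega⟩
    have : tTilde (2 * i + 1) = X i := by
      unfold tTilde; rw [if_pos (by omega)]; congr 1; omega
    rw [this, T, aeval_X, if_pos h, mul_sub, ← mul_assoc]
    congr 2
    have h3 : (((2 * i : ℕ) : Polynomial BRing) + 1)
        = Polynomial.C (MvPolynomial.C ((2 * i + 1 : ℕ) : ℂ)) := by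
      rw [map_natCast, map_natCast]; push_cast; ring
    rw [h3, ← Polynomial.C_mul, ← MvPolynomial.C_mul, mul_div_cancel₀]
    · rw [map_ofNat, map_ofNat]
    · exact_mod_cast Nat.succ_ne_zero (2 * i)
  · have : tTilde (j + 1) = 0 := by
      unfold tTilde; rw [if_neg (by omega)]
    simp [this, h]

lemma aeval_map {A A' : Type*} [CommRing A] [Algebra ℂ A] [CommRing A'] [Algebra ℂ A']
    (g : A →ₐ[ℂ] A') (c : ℕ → A) (p : MvPolynomial ℕ ℂ) :
    g (aeval c p) = aeval (fun j => g (c j)) p := by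
  rw [← AlgHom.comp_apply, MvPolynomial.comp_aeval]

lemma C_sN (n : ℕ) : Polynomial.C (sN n) =
    aeval (fun j => (Polynomial.C (tTilde j) : Polynomial BRing)) (schurPoly n) :=
  aeval_map (Polynomial.CAlgHom : BRing →ₐ[ℂ] Polynomial BRing) tTilde _

lemma u_aeval (n : ℕ) : u n = aeval (fun j => T (tTilde j)) (schurPoly n) :=
  aeval_map T tTilde _

lemma u_zero : u 0 = 1 := by simp [u, sN_zero]

lemma abs_succ {A : Type*} [CommRing A] [IsDomain A] [CharZero A] [Algebra ℂ A] (x : A)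
    (c c' : ℕ → A) (hc : ∀ j : ℕ, ((j : A) + 1) * c' (j + 1) = ((j : A) + 1) * c (j + 1) -
      (if j % 2 = 0 then 2 * x ^ (j + 1) else 0)) (n : ℕ) :
    aeval c' (schurPoly (n + 1)) = aeval c (schurPoly (n + 1)) -
      x * (aeval c' (schurPoly n) + aeval c (schurPoly n)) := by
  set w : PowerSeries A := PowerSeries.C x with hw
  set z : PowerSeries A := PowerSeries.X with hz
  set U := Eser c' with hU
  set E := Eser c with hE
  set H := Hser c with hH
  set g : PowerSeries A :=
    PowerSeries.mk fun j => if j % 2 = 0 then x ^ j else 0 with hg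
  have hginv : g - (w * z) ^ 2 * g = 1 := by
    ext1 n
    rw [hw, hz, mul_pow, ← map_pow, mul_assoc, map_sub, PowerSeries.coeff_C_mul,
      PowerSeries.coeff_X_pow_mul', PowerSeries.coeff_one]
    simp only [hg, PowerSeries.coeff_mk]
    rcases n with _ | _ | n
    · simp
    · simp
    · have : (n + 1 + 1) % 2 = n % 2 := by omega
      have h2 : 2 ≤ n + 1 + 1 := by omega
      have h3 : n + 1 + 1 - 2 = n := by omega
      have h4 : n + 1 + 1 ≠ 0 := by omega
      simp only [this, h2, h3, h4, if_true, if_false]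
      split_ifs
      · ring
      · ring
  have hK : Hser c' = H - 2 * w * g := by
    ext1 n
    rw [mul_assoc, ← map_ofNat PowerSeries.C 2, map_sub, PowerSeries.coeff_C_mul, hw, PowerSeries.coeff_C_mul]
    simp only [hg, hH, Hser, PowerSeries.coeff_mk]
    rw [hc]
    split_ifs <;> ring
  have hdU : PowerSeries.derivative _ U = (H - 2 * w * g) * U := by rw [← hK, hU, Eser_deriv]
  have hdE : PowerSeries.derivative _ E = H * E := by rw [hH, hE, Eser_deriv]
  have hdwz : PowerSeries.derivative A (w * z) = w := by
    rw [Derivation.leibniz, hz, hw, PowerSeries.derivative_X, PowerSeries.derivative_C]; simp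
  have key : (1 + w * z) * U - (1 - w * z) * E = 0 := by
    apply ode_unique (H - w * (1 + w * z) * g)
    · rw [map_sub, Derivation.leibniz, Derivation.leibniz, map_add, map_sub, hdwz, hdU, hdE]
      simp only [smul_eq_mul, Derivation.map_one_eq_zero]
      linear_combination (-w * U - w * E) * hginv
    · simp [hU, hE, Eser, aeval_schur_zero, hz, hw]
  have h4 := congrArg (PowerSeries.coeff (n + 1)) key
  have h5 : (1 + w * z) * U - (1 - w * z) * E = U - E + w * (z * (U + E)) := by ring
  rw [h5, hw, hz, map_add, PowerSeries.coeff_C_mul, PowerSeries.coeff_succ_X_mul] at h4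
  simp only [map_sub, map_add, hU, hE, Eser, PowerSeries.coeff_mk, map_zero] at h4
  linear_combination h4

lemma u_succ (n : ℕ) : u (n + 1) = Polynomial.C (sN (n + 1)) -
    Polynomial.X * (u n + Polynomial.C (sN n)) := by
  rw [u_aeval, u_aeval, C_sN, C_sN]
  exact abs_succ (A := Polynomial BRing) Polynomial.X (fun j => Polynomial.C (tTilde j))
    (fun j => T (tTilde j)) (fun j => T_tTilde j) n

end QBKP
end
noncomputable section
open MvPolynomial
namespace QBKP

def sZ (m : ℤ) : BRing := sTildeZ m

lemma sZ_nat (n : ℕ) : sZ n = sN n := by simp [sZ, sTildeZ, sN]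
lemma sZ_neg (m : ℤ) (h : m < 0) : sZ m = 0 := by simp [sZ, sTildeZ, h]

def Cm (m : ℤ) : Polynomial BRing →ₗ[BRing] BRing :=
  Polynomial.lsum fun k => LinearMap.mulLeft BRing (sZ (m + k))

lemma Cm_monomial (m : ℤ) (k : ℕ) (p : BRing) :
    Cm m (Polynomial.monomial k p) = sZ (m + k) * p := by
  simp [Cm, Polynomial.lsum_apply]

lemma Cm_C (m : ℤ) (p : BRing) : Cm m (Polynomial.C p) = sZ m * p := by
  rw [← Polynomial.monomial_zero_left, Cm_monomial]; simp

lemma Cm_one (m : ℤ) : Cm m 1 = sZ m := by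
  rw [← Polynomial.C_1, Cm_C, mul_one]

lemma Cm_mul_C (m : ℤ) (q : Polynomial BRing) (p : BRing) :
    Cm m (q * Polynomial.C p) = Cm m q * p := by
  rw [mul_comm, ← Polynomial.smul_eq_C_mul, map_smul, smul_eq_mul, mul_comm]

lemma Cm_X_mul (m : ℤ) (q : Polynomial BRing) : Cm m (Polynomial.X * q) = Cm (m + 1) q := by
  induction q using Polynomial.induction_on' with
  | add p q hp hq => rw [mul_add, map_add, map_add, hp, hq]
  | monomial k p =>
    rw [Polynomial.X_mul_monomial, Cm_monomial, Cm_monomial]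
    congr 2; push_cast; ring

lemma Cm_eq (m : ℤ) (q : Polynomial BRing) :
    ∑ᶠ k : ℕ, sTildeZ (m + k) * q.coeff k = Cm m q := by
  rw [finsum_eq_sum_of_support_subset (s := q.support)]
  · simp [Cm, Polynomial.lsum_apply, Polynomial.sum, sZ]
  · intro k hk
    simp only [Function.mem_support] at hk
    simp only [Finset.mem_coe, Polynomial.mem_support_iff]
    intro h; simp [h] at hk

lemma leftCoeff_eq (p : BRing) (m : ℤ) : leftCoeff p m = Cm m (T p) := Cm_eq m (T p)

def f : ℤ → ℕ → BRing
  | a, 0 => sZ a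
  | a, b + 1 => sZ a * sN (b + 1) - sZ (a + 1) * sN b - f (a + 1) b

lemma Cm_u (b : ℕ) : ∀ m : ℤ, Cm m (u b) = f m b := by
  induction b with
  | zero => intro m; rw [u_zero, Cm_one, f]
  | succ b ih =>
    intro m
    rw [u_succ, map_sub, Cm_C, Cm_X_mul, map_add, ih, Cm_C, f]; ring

lemma T_sZ (b : ℕ) : T (sZ b) = u b := by rw [sZ_nat]; rfl

lemma T_f (c : ℕ) : ∀ b : ℕ, T (f b c) = Polynomial.C (f b c) + u b * Polynomial.C (sN c)
    - u c * Polynomial.C (sN b) := by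
  induction c with
  | zero => intro b; rw [f, T_sZ, u_zero, sN_zero, sZ_nat]; simp
  | succ c ih =>
    intro b
    have h := ih (b + 1)
    have e : ((b + 1 : ℕ) : ℤ) = (b : ℤ) + 1 := by push_cast; ring
    rw [f, map_sub, map_sub, map_mul, map_mul, ← e, h, T_sZ, T_sZ]
    have h1 : T (sN (c + 1)) = u (c + 1) := rfl
    have h2 : T (sN c) = u c := rfl
    rw [h1, h2, sZ_nat, sZ_nat]
    simp only [map_sub, map_mul]
    have h3 := u_succ b
    have h4 := u_succ c
    linear_combination (u b + Polynomial.C (sN b)) * h4 - (u c + Polynomial.C (sN c)) * h3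

lemma f_closed (b : ℕ) : ∀ a : ℕ, f a b = sN a * sN b +
    2 * ∑ l ∈ Finset.Icc 1 b, (-1) ^ l * (sN (a + l) * sN (b - l)) := by
  induction b with
  | zero => intro a; rw [f, sZ_nat, sN_zero]; simp
  | succ b ih =>
    intro a
    have e : ((a + 1 : ℕ) : ℤ) = (a : ℤ) + 1 := by push_cast; ring
    rw [f, ← e, ih, sZ_nat, sZ_nat]
    have h : ∑ l ∈ Finset.Icc 1 (b + 1), (-1 : BRing) ^ l * (sN (a + l) * sN (b + 1 - l))
      = - (sN (a + 1) * sN b)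
        - ∑ l ∈ Finset.Icc 1 b, (-1) ^ l * (sN (a + 1 + l) * sN (b - l)) := by
      rw [← Finset.add_sum_Ioc_eq_sum_Icc (by omega : 1 ≤ b + 1)]
      have : Finset.Ioc 1 (b + 1) = (Finset.Icc 1 b).image (· + 1) := by
        ext x; simp only [Finset.mem_Ioc, Finset.mem_image, Finset.mem_Icc]
        constructor
        · intro hx; exact ⟨x - 1, by omega, by omega⟩
        · rintro ⟨y, hy, rfl⟩; omega
      rw [this, Finset.sum_image (by intro x _ y _ h; simpa using h)]
      rw [sub_eq_add_neg (- _), ← Finset.sum_neg_distrib]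
      congr 1
      · simp
      · apply Finset.sum_congr rfl
        intro l _
        rw [show a + (l + 1) = a + 1 + l by ring, show b + 1 - (l + 1) = b - l by omega]
        ring
    rw [h]; ring

lemma f_zero_left (n : ℕ) : f 0 n = (if n = 0 then 2 else 0) - sN n := by
  have h := f_closed n 0
  have h2 := sN_orth n
  rw [Finset.range_eq_Ico, Finset.sum_eq_sum_Ico_succ_bot (by omega)] at h2
  have h3 : Finset.Ico (0 + 1) (n + 1) = Finset.Icc 1 n := by
    ext x; simp only [Finset.mem_Ico, Finset.mem_Icc]; omega
  rw [h3] at h2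
  simp only [Nat.cast_zero, sN_zero, zero_add, one_mul, pow_zero, Nat.sub_zero] at h h2
  rw [h]
  split_ifs at h2 ⊢ <;> linear_combination 2 * h2

/-- `f b a`, extended by zero to negative `a`. -/
def fz (b : ℕ) (a : ℤ) : BRing := if 0 ≤ a then f b a.toNat else 0

lemma fz_rec (b : ℕ) (a : ℤ) :
    fz (b + 1) a = sN b * sZ (a + 1) - sN (b + 1) * sZ a - fz b (a + 1) := by
  rcases lt_trichotomy a (-1) with h | h | h
  · rw [fz, fz, if_neg (by omega), if_neg (by omega), sZ_neg _ (by omega), sZ_neg _ (by omega)]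
    ring
  · subst h
    have : sZ 0 = 1 := by rw [show (0:ℤ) = ((0:ℕ):ℤ) by rfl, sZ_nat, sN_zero]
    rw [fz, fz, if_neg (by omega), if_pos (by omega), sZ_neg (-1) (by omega)]
    simp [f, this, sZ_nat]
  · obtain ⟨n, rfl⟩ := Int.eq_ofNat_of_zero_le (by omega : 0 ≤ a)
    rw [fz, fz, if_pos (by omega), if_pos (by omega)]
    have e : ((n : ℤ) + 1).toNat = n + 1 := by omega
    have e2 : ((n : ℤ) + 1) = ((n + 1 : ℕ) : ℤ) := by push_cast; ring
    rw [e, Int.toNat_natCast, f, e2]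
    simp only [sZ_nat]
    push_cast
    rw [show ((b:ℤ)+1) = ((b + 1 : ℕ) : ℤ) by push_cast; ring, sZ_nat]
    ring

lemma f_anti (b : ℕ) : ∀ a : ℤ, f a b + fz b a = if a + b = 0 then 2 * (-1) ^ b else 0 := by
  induction b with
  | zero =>
    intro a
    rw [f, fz]
    by_cases h : 0 ≤ a
    · obtain ⟨n, rfl⟩ := Int.eq_ofNat_of_zero_le h
      rw [if_pos h, Int.toNat_natCast, Nat.cast_zero, f_zero_left, sZ_nat]
      simp
    · rw [if_neg h, sZ_neg _ (by omega), if_neg (by push_cast; omega)]; simp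
  | succ b ih =>
    intro a
    have h := ih (a + 1)
    rw [f, fz_rec]
    have e : (a + 1 + (b : ℤ) = 0) ↔ (a + ((b + 1 : ℕ) : ℤ) = 0) := by push_cast; constructor <;> intro <;> omega
    simp only [e] at h
    split_ifs at h ⊢
    · rw [pow_succ]; linear_combination -h
    · linear_combination -h

lemma f_skew (a b : ℕ) (h : 0 < a) : f a b = - f b a := by
  have := f_anti b a
  rw [fz, if_pos (by omega), if_neg (by omega)] at this
  rw [Int.toNat_natCast] at this
  linear_combination this

lemma f_neg (a : ℤ) (b : ℕ) (h : a < 0) (h2 : a + b ≠ 0) : f a b = 0 := by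
  have := f_anti b a
  rw [fz, if_neg (by omega), if_neg h2] at this
  simpa using this

/-! Iterated vertex operators. -/
def F : List ℕ → BRing
  | [] => 1
  | a :: L => Cm a (T (F L))

def ev (L : List ℕ) : BRing := if Even L.length then 1 else 0

def Star (L : List ℕ) : Prop :=
  T (F L) = Polynomial.C (ev L * F L) + Dop (fun b M => u b * Polynomial.C (F M)) L

lemma Star.rec_ {L : List ℕ} (h : Star L) (m : ℤ) :
    Cm m (T (F L)) = ev L * sZ m * F L + Dop (fun b M => f m b * F M) L := by
  rw [h, map_add, Cm_C]
  have := Dop_map (Cm m).toAddMonoidHom L (fun b M => u b * Polynomial.C (F M))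
  simp only [LinearMap.toAddMonoidHom_coe, Cm_mul_C, Cm_u] at this
  rw [this]; ring

lemma coeff_T_zero (p : BRing) : (T p).coeff 0 = p := by
  have : (Polynomial.aeval (R := BRing) (0 : BRing)).toRingHom.comp T.toRingHom = RingHom.id _ := by
    apply MvPolynomial.ringHom_ext
    · intro r; simp [T]
    · intro i; simp [T]
  have h := RingHom.congr_fun this p
  rw [Polynomial.coeff_zero_eq_aeval_zero]
  exact h

lemma Star.const {L : List ℕ} (h : Star L) :
    F L = ev L * F L + Dop (fun b M => sN b * F M) L := by
  have h1 := congrArg (fun q => Polynomial.coeff q 0) h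
  simp only [coeff_T_zero, Polynomial.coeff_add, Polynomial.coeff_C_zero] at h1
  have := Dop_map (Polynomial.lcoeff BRing 0).toAddMonoidHom L (fun b M => u b * Polynomial.C (F M))
  simp only [LinearMap.toAddMonoidHom_coe, Polynomial.lcoeff_apply, Polynomial.coeff_mul_C] at this
  rw [this] at h1
  simpa only [u, coeff_T_zero] using h1

lemma ev_even {L : List ℕ} (h : Even L.length) : ev L = 1 := if_pos h
lemma ev_odd {L : List ℕ} (h : ¬ Even L.length) : ev L = 0 := if_neg h

lemma F_cons {L : List ℕ} (h : Star L) (a : ℕ) :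
    F (a :: L) = ev L * sN a * F L + Dop (fun b M => f a b * F M) L := by
  rw [F, h.rec_, sZ_nat]

lemma T_Dop (L : List ℕ) (φ : ℕ → List ℕ → BRing) :
    T (Dop φ L) = Dop (fun a M => T (φ a M)) L :=
  Dop_map (T : BRing →+* Polynomial BRing).toAddMonoidHom L φ

lemma C_Dop (L : List ℕ) (φ : ℕ → List ℕ → BRing) :
    Polynomial.C (Dop φ L) = Dop (fun a M => Polynomial.C (φ a M)) L :=
  Dop_map (Polynomial.C : BRing →+* Polynomial BRing).toAddMonoidHom L φ

lemma Dop_self {R : Type*} [CommRing R] [IsDomain R] [CharZero R] (L : List ℕ) (φ : ℕ → ℕ → List ℕ → R)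
    (h : ∀ a b N, φ a b N = φ b a N) :
    Dop (fun a M => Dop (fun b N => φ a b N) M) L = 0 := by
  have h1 := Dop_swap L φ
  have h2 : (fun a M => Dop (fun b N => φ b a N) M) = (fun a M => Dop (fun b N => φ a b N) M) := by
    funext a M; refine Dop_congr _ _ _ fun b _ N _ => ?_; exact h b a N
  rw [h2] at h1
  exact self_eq_neg.1 h1

local notation "κ" => (Polynomial.C : BRing →+* Polynomial BRing)

set_option maxHeartbeats 1000000 in
lemma star_step {a : ℕ} {L : List ℕ} (hs : ∀ M : List ℕ, M.length ≤ L.length → Star M) :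
    Star (a :: L) := by
  have hL := hs L le_rfl
  unfold Star
  rw [F_cons hL a, map_add, map_mul, map_mul, T_Dop]
  simp only [map_mul, T_f, Dop]
  have hTs : T (sN a) = u a := rfl
  -- the double sums
  have dd0 : Dop (fun b M => Dop (fun c N => u b * u c * κ (F N)) M) L = 0 :=
    Dop_self L (fun b c N => u b * u c * κ (F N)) (fun b c N => by ring)
  have ddf := Dop_swap L (fun b c N => κ (f a b) * u c * κ (F N))
  have dds := Dop_swap L (fun b c N => κ (sN b) * u c * κ (F N))
  by_cases he : Even L.length
  · have he' : ¬ Even (a :: L).length := by simpa [Nat.even_add_one] using he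
    have e1 : Dop (fun b M => (κ (f a b) + u a * κ (sN b) - u b * κ (sN a)) * T (F M)) L
      = Dop (fun b M => Dop (fun c N => κ (f a b) * u c * κ (F N)) M) L
        + u a * Dop (fun b M => Dop (fun c N => κ (sN b) * u c * κ (F N)) M) L
        - κ (sN a) * Dop (fun b M => Dop (fun c N => u b * u c * κ (F N)) M) L := by
      rw [← Dop_mul, ← Dop_mul, ← Dop_add, ← Dop_sub]
      apply Dop_congr
      intro b _ M hM
      have hM' : ¬ Even M.length := by rw [← hM, Nat.even_add_one] at he; exact he
      rw [hs M (by omega), ev_odd hM', zero_mul, map_zero, zero_add]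
      rw [← Dop_mul, ← Dop_mul, ← Dop_mul, ← Dop_add, ← Dop_sub]
      refine Dop_congr _ _ _ fun c _ N _ => ?_; ring
    have e2 : Dop (fun b M => u b * κ (F (a :: M))) L
      = Dop (fun b M => Dop (fun c N => κ (f a c) * u b * κ (F N)) M) L := by
      apply Dop_congr
      intro b _ M hM
      have hM' : ¬ Even M.length := by rw [← hM, Nat.even_add_one] at he; exact he
      rw [F_cons (hs M (by omega)), ev_odd hM', zero_mul, zero_mul, zero_add, C_Dop, ← Dop_mul]
      refine Dop_congr _ _ _ fun c _ N _ => ?_; rw [map_mul]; ring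
    have e3 : Dop (fun b M => u b * κ (F M)) L
      = Dop (fun b M => Dop (fun c N => κ (sN c) * u b * κ (F N)) M) L := by
      apply Dop_congr
      intro b _ M hM
      have hM' : ¬ Even M.length := by rw [← hM, Nat.even_add_one] at he; exact he
      rw [(hs M (by omega)).const, ev_odd hM', zero_mul, zero_add, C_Dop, ← Dop_mul]
      refine Dop_congr _ _ _ fun c _ N _ => ?_; rw [map_mul]; ring
    rw [e1, e2, hL, ev_even he, ev_odd he', dd0, ddf, dds, ← e3, hTs]
    simp only [map_zero, map_one, zero_mul, one_mul]
    ring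
  · have he' : Even (a :: L).length := by simpa [Nat.even_add_one] using he
    have hcs : Dop (fun b M => κ (sN b) * κ (F M)) L = κ (F L) := by
      conv_rhs => rw [hL.const, ev_odd he, zero_mul, zero_add, C_Dop]
      simp only [map_mul]
    have hcf : Dop (fun b M => κ (f a b) * κ (F M)) L = κ (F (a :: L)) := by
      rw [F_cons hL, ev_odd he, zero_mul, zero_mul, zero_add, C_Dop]
      simp only [map_mul]
    have e1 : Dop (fun b M => (κ (f a b) + u a * κ (sN b) - u b * κ (sN a)) * T (F M)) L
      = Dop (fun b M => κ (f a b) * κ (F M)) L + u a * Dop (fun b M => κ (sN b) * κ (F M)) L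
        - κ (sN a) * Dop (fun b M => u b * κ (F M)) L
        + Dop (fun b M => Dop (fun c N => κ (f a b) * u c * κ (F N)) M) L
        + u a * Dop (fun b M => Dop (fun c N => κ (sN b) * u c * κ (F N)) M) L
        - κ (sN a) * Dop (fun b M => Dop (fun c N => u b * u c * κ (F N)) M) L := by
      simp only [← Dop_mul, ← Dop_add, ← Dop_sub]
      apply Dop_congr
      intro b _ M hM
      have hM' : Even M.length := by rw [← hM, Nat.even_add_one, not_not] at he; exact he
      rw [hs M (by omega), ev_even hM', one_mul, mul_add, ← Dop_mul]
      have : ∀ x y : Polynomial BRing, ∀ p q r : Polynomial BRing,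
        x + y = x + (p + q - r) ↔ y = p + q - r := by intros; simp
      have e4 : Dop (fun c N => (κ (f a b) + u a * κ (sN b) - u b * κ (sN a)) * (u c * κ (F N))) M
        = Dop (fun c N => κ (f a b) * u c * κ (F N)) M
          + Dop (fun c N => u a * (κ (sN b) * u c * κ (F N))) M
          - Dop (fun c N => κ (sN a) * (u b * u c * κ (F N))) M := by
        rw [← Dop_add, ← Dop_sub]
        refine Dop_congr _ _ _ fun c _ N _ => ?_; ring
      rw [e4]
      ring
    have e2 : Dop (fun b M => u b * κ (F (a :: M))) L
      = κ (sN a) * Dop (fun b M => u b * κ (F M)) L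
        + Dop (fun b M => Dop (fun c N => κ (f a c) * u b * κ (F N)) M) L := by
      rw [← Dop_mul, ← Dop_add]
      apply Dop_congr
      intro b _ M hM
      have hM' : Even M.length := by rw [← hM, Nat.even_add_one, not_not] at he; exact he
      rw [F_cons (hs M (by omega)), ev_even hM', one_mul, map_add, C_Dop, mul_add, ← Dop_mul, map_mul]
      refine congrArg₂ (· + ·) ?_ ?_
      · ring
      · refine Dop_congr _ _ _ fun c _ N _ => ?_; rw [map_mul]; ring
    have e3 : Dop (fun b M => Dop (fun c N => κ (sN c) * u b * κ (F N)) M) L = 0 := by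
      rw [← Dop_zero L]
      apply Dop_congr
      intro b _ M hM
      have hM' : Even M.length := by rw [← hM, Nat.even_add_one, not_not] at he; exact he
      have h5 := (hs M (by omega)).const
      rw [ev_even hM', one_mul] at h5
      have h6 : Dop (fun b M => sN b * F M) M = 0 := by linear_combination -h5
      have h7 : Dop (fun c N => κ (sN c) * u b * κ (F N)) M = u b * κ (Dop (fun b M => sN b * F M) M) := by
        rw [C_Dop, ← Dop_mul]; refine Dop_congr _ _ _ fun c _ N _ => ?_; rw [map_mul]; ring
      rw [h7, h6]; simp
    rw [e1, e2, ev_odd he, ev_even he', dd0, ddf, dds, e3, hcs, hcf]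
    rw [F_cons hL, ev_odd he]
    simp only [map_zero, map_one, zero_mul, one_mul, zero_add]
    ring

lemma star_all : ∀ (n : ℕ) (L : List ℕ), L.length ≤ n → Star L := by
  intro n
  induction n with
  | zero =>
    intro L h
    have : L = [] := List.eq_nil_of_length_eq_zero (by omega)
    subst this
    simp [Star, F, ev, Dop]
  | succ n ih =>
    intro L h
    cases L with
    | nil => exact ih _ (by simp)
    | cons a L =>
      apply star_step
      intro M hM
      apply ih
      simp at h
      omega

lemma star (L : List ℕ) : Star L := star_all _ L le_rfl

lemma F_swap (a b : ℕ) (h : 0 < a) (M : List ℕ) : F (a :: b :: M) = - F (b :: a :: M) := by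
  have dd := Dop_swap M (fun c d N => f a c * f b d * F N)
  have key : ∀ a b : ℕ, F (a :: b :: M) =
      (if Even M.length then 0 else sN a * Dop (fun c N => f b c * F N) M - sN b * Dop (fun c N => f a c * F N) M)
      + f a b * F M - Dop (fun c N => Dop (fun d N' => f a c * f b d * F N') N) M := by
    intro a b
    rw [F_cons (star _)]
    simp only [Dop]
    by_cases he : Even M.length
    · have he' : ¬ Even (b :: M).length := by simpa [Nat.even_add_one] using he
      rw [ev_odd he', if_pos he]
      have : Dop (fun c N => f a c * F (b :: N)) M =
        Dop (fun c N => Dop (fun d N' => f a c * f b d * F N') N) M := by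
        apply Dop_congr
        intro c _ N hN
        have hN' : ¬ Even N.length := by rw [← hN, Nat.even_add_one] at he; exact he
        rw [F_cons (star _), ev_odd hN', zero_mul, zero_mul, zero_add, ← Dop_mul]
        refine Dop_congr _ _ _ fun d _ N' _ => ?_; ring
      rw [this]; ring
    · have he' : Even (b :: M).length := by simpa [Nat.even_add_one] using he
      rw [ev_even he', if_neg he, F_cons (star M), ev_odd he]
      have : Dop (fun c N => f a c * F (b :: N)) M = sN b * Dop (fun c N => f a c * F N) M +
        Dop (fun c N => Dop (fun d N' => f a c * f b d * F N') N) M := by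
        rw [← Dop_mul, ← Dop_add]
        apply Dop_congr
        intro c _ N hN
        have hN' : Even N.length := by rw [← hN, Nat.even_add_one, not_not] at he; exact he
        rw [F_cons (star _), ev_even hN', one_mul, mul_add, ← Dop_mul]
        refine congrArg₂ (· + ·) ?_ ?_
        · ring
        · refine Dop_congr _ _ _ fun d _ N' _ => ?_; ring
      rw [this]; ring
  rw [key a b, key b a, dd, f_skew a b h]
  have : (fun c N => Dop (fun d N' => f a d * f b c * F N') N) =
    (fun c N => Dop (fun d N' => f b c * f a d * F N') N) := by
    funext c N; refine Dop_congr _ _ _ fun d _ N' _ => ?_; ring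
  rw [this]
  split_ifs <;> ring

lemma F_mem (a : ℕ) (h : 0 < a) (L : List ℕ) (hL : a ∈ L) : F (a :: L) = 0 := by
  induction L with
  | nil => simp at hL
  | cons b L ih =>
    by_cases hb : a = b
    · subst hb
      exact self_eq_neg.1 (F_swap a a h L)
    · have : a ∈ L := by simpa [hb] using hL
      rw [F_swap a b h, F, ih this]; simp

lemma F_neg (m : ℤ) (h : m < 0) (L : List ℕ) (hL : ∀ b ∈ L, m + (b : ℤ) ≠ 0) :
    Cm m (T (F L)) = 0 := by
  rw [(star L).rec_, sZ_neg m h, mul_zero, zero_mul, zero_add, ← Dop_zero L]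
  apply Dop_congr
  intro b hb M _
  rw [f_neg m b h (hL b hb), zero_mul]

lemma F_append_zero (M : List ℕ) : F (M ++ [0]) = F M := by
  induction M with
  | nil => simp [F, Cm_one]; rw [show (0:ℤ) = ((0:ℕ):ℤ) by rfl, sZ_nat, sN_zero]
  | cons a M ih => simp [F, ih]

lemma X_zero (L : List ℕ) (he : Even L.length) :
    Cm 0 (T (F L)) = F L + Dop (fun b M => (if b = 0 then 2 else 0) * F M) L := by
  have h0 : sZ 0 = 1 := by rw [show (0:ℤ) = ((0:ℕ):ℤ) by rfl, sZ_nat, sN_zero]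
  have h1 := (star L).const
  rw [ev_even he, one_mul] at h1
  rw [(star L).rec_, ev_even he, h0]
  simp only [f_zero_left, sub_mul]
  rw [Dop_sub]
  linear_combination h1

lemma X_zero_sign (L : List ℕ) (he : Even L.length) (hp : L.Pairwise (· > ·)) :
    Cm 0 (T (F L)) = F L ∨ Cm 0 (T (F L)) = - F L := by
  rw [X_zero L he]
  by_cases h0 : 0 ∈ L
  · right
    rcases List.eq_nil_or_concat L with rfl | ⟨M, x, rfl⟩
    · simp at h0
    · rw [List.concat_eq_append] at *
      rw [List.pairwise_append] at hp
      have hM : 0 ∉ M := by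
        intro hm
        have := hp.2.2 0 hm x (by simp)
        omega
      have hx : x = 0 := by
        simp [hM] at h0; omega
      subst hx
      rw [Dop_append 0 M _ (by intro a ha N; simp [ha]) hM, F_append_zero]
      have hodd : Odd M.length := by
        simp [Nat.even_add_one] at he
        exact he
      rw [hodd.neg_one_pow]; simp; ring
  · left
    rw [Dop_congr L _ (fun _ _ => 0), Dop_zero, add_zero]
    intro b hb M _
    have : b ≠ 0 := by rintro rfl; exact h0 hb
    simp [this]

/-! The right vertex operator. -/
lemma sTildeNegZ_eq (m : ℤ) : sTildeNegZ m = (-1 : BRing) ^ m.natAbs * sZ m := by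
  unfold sTildeNegZ sZ sTildeZ
  split_ifs with h
  · rw [sNeg]; congr 2; omega
  · simp

lemma neg_pow_odd {R : Type*} [CommRing R] (i : ℕ) (x : R) :
    (-x) ^ (2 * i + 1) = - x ^ (2 * i + 1) := Odd.neg_pow ⟨i, rfl⟩ x

lemma aux_ring1 {R : Type*} [CommRing R] (a b x : R) : a + b * x = a - b * -x := by ring

lemma aux_ring2 {R : Type*} [CommRing R] (x : R) : -x = -1 * x := by ring

lemma shiftPlus_coeff (p : BRing) (k : ℕ) : (shiftPlus p).coeff k = (-1) ^ k * (T p).coeff k := by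
  have : shiftPlus p = (T p).comp (-Polynomial.X) := by
    have h : (MvPolynomial.aeval (fun i => Polynomial.C (MvPolynomial.X i) +
      Polynomial.C (MvPolynomial.C ((2 : ℂ) / ((2 * i + 1 : ℕ) : ℂ))) *
        Polynomial.X ^ (2 * i + 1)) : BRing →ₐ[ℂ] Polynomial BRing).toRingHom
        = (Polynomial.compRingHom (-Polynomial.X)).comp T.toRingHom := by
      apply MvPolynomial.ringHom_ext
      · intro r; simp [T, Polynomial.algebraMap_apply]
      · intro i
        have h2 : (-Polynomial.X : Polynomial BRing) ^ (2 * i + 1) = - Polynomial.X ^ (2 * i + 1) :=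
          neg_pow_odd i _
        have h3 : ∀ g : ℕ → Polynomial BRing, (aeval g : BRing →ₐ[ℂ] Polynomial BRing).toRingHom (X i) = g i :=
          fun g => aeval_X g i
        rw [T, RingHom.comp_apply, h3, h3, Polynomial.coe_compRingHom_apply, Polynomial.sub_comp,
          Polynomial.mul_comp, Polynomial.C_comp, Polynomial.C_comp, Polynomial.X_pow_comp, h2]
        exact aux_ring1 _ _ _
    exact RingHom.congr_fun h p
  rw [this]
  have h1 : (-Polynomial.X : Polynomial BRing) = Polynomial.C (-1) * Polynomial.X := by
    rw [map_neg, map_one]; exact aux_ring2 _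
  rw [h1, Polynomial.comp_C_mul_X_coeff, mul_comm]

lemma rightCoeff_eq (p : BRing) (m : ℤ) : rightCoeff p m = (-1 : BRing) ^ m.natAbs * Cm m (T p) := by
  have hh : ∀ k : ℕ, sTildeNegZ (m + k) * (shiftPlus p).coeff k
      = (-1 : BRing) ^ m.natAbs * (sTildeZ (m + k) * (T p).coeff k) := by
    intro k
    rw [sTildeNegZ_eq, shiftPlus_coeff]
    have : (-1 : BRing) ^ (m + k).natAbs * (-1) ^ k = (-1) ^ m.natAbs := by
      rw [← pow_add]
      apply neg_one_pow_congr
      simp only [Nat.even_iff]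
      omega
    rw [← this, sZ]; ring
  unfold rightCoeff
  rw [finsum_congr hh, ← Cm_eq, mul_finsum]

lemma BKP_F (L : List ℕ) (he : Even L.length) (hp : L.Pairwise (· > ·)) : SatisfiesBKP (F L) := by
  unfold SatisfiesBKP
  simp only [leftCoeff_eq, rightCoeff_eq]
  rw [finsum_eq_single _ (0 : ℤ)]
  · rcases X_zero_sign L he hp with h | h
    · simp [h]
    · simp [h]
  · have key : ∀ m : ℤ, 0 < m → Cm m (T (F L)) = 0 ∨ Cm (-m) (T (F L)) = 0 := by
      intro m hm
      obtain ⟨n, rfl⟩ := Int.eq_ofNat_of_zero_le hm.le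
      by_cases hn : n ∈ L
      · left; exact F_mem n (by omega) L hn
      · right
        apply F_neg _ (by omega)
        intro b hb h
        have : b = n := by omega
        exact hn (this ▸ hb)
    intro m hm
    rcases lt_or_gt_of_ne hm with h | h
    · rcases key (-m) (by omega) with h | h
      · simp [h]
      · rw [neg_neg] at h; simp [h]
    · rcases key m h with h | h <;> simp [h]

lemma BKP_smul (c : ℂ) (p : BRing) (h : SatisfiesBKP p) : SatisfiesBKP (c • p) := by
  unfold SatisfiesBKP at *
  have hC : ∀ (m : ℤ), Cm m (T (c • p)) = MvPolynomial.C c * Cm m (T p) := by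
    intro m
    have h1 : T (c • p) = (MvPolynomial.C c : BRing) • T p := by
      rw [map_smul T c p, Polynomial.smul_eq_C_mul, Algebra.smul_def]; rfl
    rw [h1, map_smul, smul_eq_mul]
  simp only [leftCoeff_eq, rightCoeff_eq, hC] at h ⊢
  have e : ∀ m : ℤ, inL (C c * Cm m (T p)) * inR ((-1) ^ (-m).natAbs * (C c * Cm (-m) (T p)))
    = (inL (C c) * inR (C c)) * (inL (Cm m (T p)) * inR ((-1) ^ (-m).natAbs * Cm (-m) (T p))) := by
    intro m; simp only [map_mul]; ring
  rw [finsum_congr e, smul_eq_C_mul, map_mul, map_mul]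
  rw [show inL (C c) * inL p * (inR (C c) * inR p) = (inL (C c) * inR (C c)) * (inL p * inR p) by ring, ← h]
  rw [mul_finsum]

end QBKP
end
noncomputable section
open MvPolynomial
namespace QBKP

def Psi {m : ℕ} (q : Fin (m + 1) × Equiv.Perm (Fin m)) : Equiv.Perm (Fin (m + 1)) :=
  (q.1.cycleRange)⁻¹ * Equiv.Perm.decomposeFin.symm (0, q.2)

lemma Psi_zero {m : ℕ} (q : Fin (m + 1) × Equiv.Perm (Fin m)) : Psi q 0 = q.1 := by
  rw [Psi, Equiv.Perm.mul_apply, Equiv.Perm.decomposeFin_symm_apply_zero]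
  exact Fin.cycleRange_symm_zero _

lemma Psi_succ {m : ℕ} (q : Fin (m + 1) × Equiv.Perm (Fin m)) (i : Fin m) :
    Psi q i.succ = q.1.succAbove (q.2 i) := by
  rw [Psi, Equiv.Perm.mul_apply, Equiv.Perm.decomposeFin_symm_apply_succ]
  simp only [Equiv.swap_self, Equiv.refl_apply]
  exact Fin.cycleRange_symm_succ _ _

lemma Psi_sign {m : ℕ} (q : Fin (m + 1) × Equiv.Perm (Fin m)) :
    Equiv.Perm.sign (Psi q) = (-1) ^ (q.1 : ℕ) * Equiv.Perm.sign q.2 := by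
  rw [Psi, map_mul, map_inv, Fin.sign_cycleRange, Equiv.Perm.decomposeFin.symm_sign]
  simp

lemma Psi_bij {m : ℕ} : Function.Bijective (Psi (m := m)) := by
  rw [Fintype.bijective_iff_injective_and_card]
  constructor
  · rintro ⟨k, σ⟩ ⟨k', σ'⟩ h
    have h0 : k = k' := by
      have := congrArg (fun e : Equiv.Perm (Fin (m + 1)) => e 0) h
      simpa only [Psi_zero] using this
    subst h0
    congr 1
    ext1 i
    have := congrArg (fun e : Equiv.Perm (Fin (m + 1)) => e i.succ) h
    simp only [Psi_succ] at this
    exact Fin.succAbove_right_injective this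
  · simp [Fintype.card_perm, Nat.factorial_succ]

def Phi {m : ℕ} (q : Fin (m + 1) × Equiv.Perm (Fin m)) : Equiv.Perm (Fin (m + 2)) :=
  Equiv.Perm.decomposeFin.symm (0, Psi q)

lemma Phi_sign {m : ℕ} (q : Fin (m + 1) × Equiv.Perm (Fin m)) :
    Equiv.Perm.sign (Phi q) = (-1) ^ (q.1 : ℕ) * Equiv.Perm.sign q.2 := by
  rw [Phi, Equiv.Perm.decomposeFin.symm_sign, Psi_sign]; simp

lemma Phi_zero {m : ℕ} (q : Fin (m + 1) × Equiv.Perm (Fin m)) (h : 0 < m + 2) :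
    Phi q ⟨0, h⟩ = 0 := Equiv.Perm.decomposeFin_symm_apply_zero _ _

lemma Phi_succ {m : ℕ} (q : Fin (m + 1) × Equiv.Perm (Fin m)) (i : Fin (m + 1)) :
    Phi q i.succ = (Psi q i).succ := by
  rw [Phi, Equiv.Perm.decomposeFin_symm_apply_succ]; simp

lemma Phi_one {m : ℕ} (q : Fin (m + 1) × Equiv.Perm (Fin m)) (h : 1 < m + 2) :
    Phi q ⟨1, h⟩ = q.1.succ := by
  have := Phi_succ q 0
  rw [Psi_zero] at this
  exact this

lemma Phi_ss {m : ℕ} (q : Fin (m + 1) × Equiv.Perm (Fin m)) (i j : ℕ) (hj : j < m) (h : i < m + 2)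
    (hij : i = j + 2) :
    Phi q ⟨i, h⟩ = (q.1.succAbove (q.2 ⟨j, hj⟩)).succ := by
  subst hij
  have := Phi_succ q (⟨j, hj⟩ : Fin m).succ
  rw [Psi_succ] at this
  exact this

lemma Phi_cond {m : ℕ} (q : Fin (m + 1) × Equiv.Perm (Fin m)) :
    pfaffianCond (Phi q) ↔ pfaffianCond q.2 := by
  have hd : (m + 2) / 2 = m / 2 + 1 := by omega
  have hmono : ∀ x y : Fin m, (q.1.succAbove x).succ < (q.1.succAbove y).succ ↔ x < y := by
    intro x y
    rw [Fin.succ_lt_succ_iff, Fin.succAbove_lt_succAbove_iff]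
  constructor
  · rintro ⟨h1, h2⟩
    refine ⟨fun i => ?_, fun i j hij => ?_⟩
    · have := h1 ⟨i + 1, by omega⟩
      rw [Phi_ss q _ (2 * i) (by omega) _ (by simp; ring),
        Phi_ss q _ (2 * i + 1) (by omega) _ (by simp; ring), hmono] at this
      exact this
    · have := h2 ⟨i + 1, by omega⟩ ⟨j + 1, by omega⟩ (by rw [Fin.lt_def] at hij ⊢; exact Nat.succ_lt_succ hij)
      rw [Phi_ss q _ (2 * i) (by omega) _ (by simp; ring),
        Phi_ss q _ (2 * j) (by omega) _ (by simp; ring), hmono] at this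
      exact this
  · rintro ⟨h1, h2⟩
    refine ⟨?_, ?_⟩
    · rintro ⟨i, hi⟩
      rcases i with _ | i
      · simp only [Nat.mul_zero, Nat.zero_add]
        rw [Phi_zero, Phi_one]
        exact Fin.succ_pos _
      · rw [Phi_ss q _ (2 * i) (by omega) _ (by simp; ring),
          Phi_ss q _ (2 * i + 1) (by omega) _ (by simp; ring), hmono]
        exact h1 ⟨i, by omega⟩
    · rintro ⟨i, hi⟩ ⟨j, hj⟩ hij
      rw [Fin.lt_def] at hij
      simp only at hij
      rcases j with _ | j
      · omega
      rcases i with _ | i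
      · simp only [Nat.mul_zero]
        rw [Phi_zero, Phi_ss q _ (2 * j) (by omega) _ (by ring)]
        exact Fin.succ_pos _
      · rw [Phi_ss q _ (2 * i) (by omega) _ (by simp; ring),
          Phi_ss q _ (2 * j) (by omega) _ (by simp; ring), hmono]
        exact h2 ⟨i, by omega⟩ ⟨j, by omega⟩ (by rw [Fin.lt_def]; exact Nat.lt_of_succ_lt_succ hij)

lemma cond_zero {m : ℕ} (hm : Even m) (σ : Equiv.Perm (Fin (m + 2))) (h : pfaffianCond σ) :
    σ 0 = 0 := by
  obtain ⟨k, rfl⟩ := hm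
  obtain ⟨h1, h2⟩ := h
  obtain ⟨⟨j, hj⟩, hσ⟩ := σ.surjective 0
  rcases Nat.even_or_odd' j with ⟨i, rfl | rfl⟩
  · rcases Nat.eq_zero_or_pos i with rfl | hi
    · exact hσ
    · have := h2 ⟨0, by omega⟩ ⟨i, by omega⟩ (by rw [Fin.lt_def]; exact hi)
      simp only at this
      rw [hσ] at this
      exact absurd this (Fin.not_lt_zero _)
  · have := h1 ⟨i, by omega⟩
    simp only at this
    rw [hσ] at this
    exact absurd this (Fin.not_lt_zero _)

lemma pfaffian_expand {R : Type*} [CommRing R] {m : ℕ} (hm : Even m)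
    (A : Matrix (Fin (m + 2)) (Fin (m + 2)) R) :
    pfaffian A = ∑ k : Fin (m + 1), (-1) ^ (k : ℕ) * (A 0 k.succ *
      pfaffian (A.submatrix (fun i => (k.succAbove i).succ) (fun i => (k.succAbove i).succ))) := by
  classical
  unfold pfaffian
  rw [← Equiv.sum_comp Equiv.Perm.decomposeFin.symm, Fintype.sum_prod_type,
    Finset.sum_eq_single (0 : Fin (m + 2))]
  · rw [← Function.Bijective.sum_comp Psi_bij, Fintype.sum_prod_type]
    apply Finset.sum_congr rfl
    intro k _
    rw [Finset.mul_sum, Finset.mul_sum]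
    apply Finset.sum_congr rfl
    intro σ _
    change (if pfaffianCond (Phi (k, σ)) then (Equiv.Perm.sign (Phi (k, σ)) : ℤ) •
      ∏ i : Fin ((m + 2) / 2), A (Phi (k, σ) ⟨2 * i.val, _⟩) (Phi (k, σ) ⟨2 * i.val + 1, _⟩)
      else 0) = _
    by_cases hc : pfaffianCond σ
    · rw [if_pos ((Phi_cond (k, σ)).2 hc), if_pos hc, Phi_sign]
      have hd : m / 2 + 1 = (m + 2) / 2 := by omega
      rw [← Equiv.prod_comp (finCongr hd), Fin.prod_univ_succ]
      have e1 : ∀ i : Fin (m / 2), A (Phi (k, σ) ⟨2 * ((finCongr hd) i.succ).val, by have := i.isLt; simp; omega⟩)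
          (Phi (k, σ) ⟨2 * ((finCongr hd) i.succ).val + 1, by have := i.isLt; simp; omega⟩)
          = (A.submatrix (fun i => (k.succAbove i).succ) (fun i => (k.succAbove i).succ))
            (σ ⟨2 * i.val, by have := i.isLt; omega⟩) (σ ⟨2 * i.val + 1, by have := i.isLt; omega⟩) := by
        intro i
        rw [Phi_ss (k, σ) _ (2 * i) (by omega) _ (by simp; ring),
          Phi_ss (k, σ) _ (2 * i + 1) (by omega) _ (by simp; ring)]
        rfl
      have e0 : A (Phi (k, σ) ⟨2 * ((finCongr hd) 0).val, by simp⟩)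
          (Phi (k, σ) ⟨2 * ((finCongr hd) 0).val + 1, by simp⟩) = A 0 k.succ := by
        have a1 := Phi_zero (k, σ) (by omega)
        have a2 := Phi_one (k, σ) (by omega)
        simp only [finCongr_apply, Fin.val_cast, Fin.val_zero, Nat.mul_zero, Nat.zero_add]
        rw [a1, a2]
      rw [Finset.prod_congr rfl (fun i _ => e1 i), e0]
      simp only [zsmul_eq_mul]
      push_cast
      ring
    · rw [if_neg (fun h => hc ((Phi_cond (k, σ)).1 h)), if_neg hc]; simp
  · intro p _ hp
    apply Finset.sum_eq_zero
    intro τ _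
    rw [if_neg]
    intro h
    have := cond_zero hm _ h
    rw [Equiv.Perm.decomposeFin_symm_apply_zero] at this
    exact hp this
  · simp

lemma pfaffian_empty {R : Type*} [CommRing R] (A : Matrix (Fin 0) (Fin 0) R) : pfaffian A = 1 := by
  simp [pfaffian, pfaffianCond]

lemma tShift_zero : tShift (fun _ => 0) = tTilde := by
  funext j; simp [tShift]

lemma chi_eq (a b : ℕ) : chiB a b tTilde tTilde = (2 : ℂ)⁻¹ • f a b := by
  rw [f_closed, chiB, smul_add]
  refine congrArg₂ (· + ·) rfl ?_
  rw [Algebra.smul_def, ← mul_assoc]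
  have : algebraMap ℂ BRing 2⁻¹ * 2 = 1 := by
    rw [← map_ofNat (algebraMap ℂ BRing) 2, ← map_mul]; norm_num
  rw [this, one_mul]
  apply Finset.sum_congr rfl
  intro l _
  rw [Algebra.smul_def, map_pow, map_neg, map_one]
  rfl

lemma chi_sub {m m' : ℕ} (lam : Fin m → ℕ) (g : Fin m' → Fin m) (hg : StrictMono g) :
    (chiMatrix lam (fun _ _ => 0)).submatrix g g = chiMatrix (fun i => lam (g i)) (fun _ _ => 0) := by
  ext1 i j
  simp only [Matrix.submatrix_apply, chiMatrix, skewOf, Matrix.of_apply, hg.lt_iff_lt]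

lemma pf_eq (n : ℕ) : ∀ (lam : Fin (2 * n) → ℕ),
    pfaffian (chiMatrix lam fun _ _ => 0) = ((2 : ℂ)⁻¹) ^ n • F (List.ofFn lam) := by
  induction n with
  | zero =>
    intro lam
    have h : List.ofFn lam = [] := List.ofFn_zero
    rw [h, F, pow_zero, one_smul]
    exact pfaffian_empty (chiMatrix (m := 0) lam fun _ _ => 0)
  | succ n ih =>
    intro lam
    change Fin (2 * n + 2) → ℕ at lam
    change pfaffian (chiMatrix (m := 2 * n + 2) lam fun _ _ => 0)
      = _ • F (List.ofFn (n := 2 * n + 1 + 1) lam)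
    rw [pfaffian_expand ⟨n, by ring⟩, List.ofFn_succ, F_cons (star _), ev_odd (by simp),
      zero_mul, zero_mul, zero_add, Dop_ofFn, Finset.smul_sum]
    apply Finset.sum_congr rfl
    intro k _
    rw [chi_sub lam _ (fun i j hij => by simpa [Fin.succAbove_lt_succAbove_iff] using hij), ih]
    have : chiMatrix lam (fun _ _ => 0) 0 k.succ = (2 : ℂ)⁻¹ • f (lam 0) (lam k.succ) := by
      rw [← chi_eq, chiMatrix, skewOf, Matrix.of_apply, if_pos (Fin.succ_pos k), tShift_zero]
    rw [this, pow_succ, smul_mul_smul_comm, mul_smul_comm, mul_comm ((2 : ℂ)⁻¹)]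

end QBKP
end

noncomputable section

/-- You's theorem, the case `c_1 = ⋯ = c_{2n} = 0`. For every extended
strict partition `λ_1 > ⋯ > λ_{2n} ≥ 0`, the polynomial
`Pf( χ_{λ_i,λ_j}(t̃, t̃) )_{1≤i,j≤2n}` (up to normalization, the Schur `Q`-function of `λ`)
satisfies the BKP bilinear identity. -/
theorem Q_schur_BKP (n : ℕ) (lam : Fin (2 * n) → ℕ) (hlam : StrictAnti lam) :
    SatisfiesBKP (pfaffian (chiMatrix lam fun _ _ => 0)) := by
  rw [QBKP.pf_eq]
  apply QBKP.BKP_smul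
  apply QBKP.BKP_F
  · simp
  · rw [List.pairwise_ofFn]
    intro i j hij
    exact hlam hij

end
end

section
/- Let n ≥ 0, let λ_1 > λ_2 > ⋯ > λ_{2n} ≥ 0 be integers, let c_1, …, c_{2n} be sequences of complex numbers and b_1, …, b_{2n} ∈ ℂ. Then the polynomial τ_0(t_1,t_3,t_5,…) = Pf( ρ_{λ_i,λ_j}(t̃ + c_i, t̃ + c_j; b_i, b_j) )_{1≤i,j≤2n} satisfies the BKP bilinear identity (which is the bosonic form of the DKP hierarchy on the even sector V_0). -/
noncomputable section
open Equiv Finset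

def FF {R : Type*} [CommRing R] {n : ℕ} (A : Matrix (Fin n × Fin 2) (Fin n × Fin 2) R) : R :=
  ∑ σ : Perm (Fin n × Fin 2), ((Perm.sign σ : ℤ) : R) * ∏ i, A (σ (i, 0)) (σ (i, 1))

lemma prod_pairs {R : Type*} [CommRing R] {n : ℕ} (g : Fin n × Fin 2 → R) :
    ∏ x, g x = ∏ i, (g (i, 0) * g (i, 1)) := by
  simp [Fintype.prod_prod_type, Fin.prod_univ_two]

lemma prod_sum_pairs {R : Type*} [CommRing R] {n : ℕ} {κ : Type*} [Fintype κ] [DecidableEq κ]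
    (G : Fin n → κ → κ → R) :
    ∏ i, ∑ p, ∑ q, G i p q = ∑ f : Fin n × Fin 2 → κ, ∏ i, G i (f (i, 0)) (f (i, 1)) := by
  have h1 : ∀ i, ∑ p, ∑ q, G i p q = ∑ r : κ × κ, G i r.1 r.2 := by
    intro i; rw [Fintype.sum_prod_type]
  simp_rw [h1]
  rw [Finset.prod_univ_sum, Fintype.piFinset_univ]
  symm
  refine Fintype.sum_equiv ((Equiv.curry _ _ _).trans (Equiv.arrowCongr (Equiv.refl _) (finTwoArrowEquiv κ))) _ _ ?_
  intro f
  simp [Equiv.arrowCongr, finTwoArrowEquiv]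

lemma FF_congr {R : Type*} [CommRing R] {n : ℕ} (A B : Matrix (Fin n × Fin 2) (Fin n × Fin 2) R) :
    FF (B * A * B.transpose) = B.det * FF A := by
  have h0 : ∀ σ : Perm (Fin n × Fin 2), ∏ i, (B * A * B.transpose) (σ (i, 0)) (σ (i, 1)) =
      ∑ f : Fin n × Fin 2 → Fin n × Fin 2, (∏ x, B (σ x) (f x)) * ∏ i, A (f (i, 0)) (f (i, 1)) := by
    intro σ
    have : ∀ i : Fin n, (B * A * B.transpose) (σ (i, 0)) (σ (i, 1)) =
        ∑ p, ∑ q, (B (σ (i, 0)) p * B (σ (i, 1)) q * A p q) := by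
      intro i
      simp only [Matrix.mul_apply, Matrix.transpose_apply, Finset.sum_mul]
      rw [Finset.sum_comm]
      refine Finset.sum_congr rfl fun p _ => Finset.sum_congr rfl fun q _ => by ring
    simp_rw [this]
    rw [prod_sum_pairs (fun i p q => B (σ (i, 0)) p * B (σ (i, 1)) q * A p q)]
    refine Finset.sum_congr rfl fun f _ => ?_
    rw [Finset.prod_mul_distrib, prod_pairs]
  unfold FF
  simp_rw [h0, Finset.mul_sum]
  rw [Finset.sum_comm]
  have h1 : ∀ f : Fin n × Fin 2 → Fin n × Fin 2,
      ∑ σ : Perm (Fin n × Fin 2), ((Perm.sign σ : ℤ) : R) *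
        ((∏ x, B (σ x) (f x)) * ∏ i, A (f (i, 0)) (f (i, 1))) =
      (B.submatrix id f).det * ∏ i, A (f (i, 0)) (f (i, 1)) := by
    intro f
    rw [Matrix.det_apply', Finset.sum_mul]
    refine Finset.sum_congr rfl fun σ _ => by simp [mul_assoc]
  simp_rw [h1]
  rw [← Finset.sum_subset (Finset.subset_univ ((Finset.univ : Finset (Perm (Fin n × Fin 2))).image (fun σ x => σ x)))]
  · rw [Finset.sum_image]
    · refine Finset.sum_congr rfl fun σ _ => ?_
      have := Matrix.det_permute' σ B
      rw [show (fun x => σ x) = ⇑σ from rfl, this]; ring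
    · intro σ _ τ _ h
      exact Equiv.ext (congrFun h)
  · intro f _ hf
    have : ¬ Function.Injective f := by
      intro hi
      apply hf
      simp only [Finset.mem_image, Finset.mem_univ, true_and]
      exact ⟨Equiv.ofBijective f (Finite.injective_iff_bijective.1 hi), rfl⟩
    simp only [Function.Injective, not_forall] at this
    obtain ⟨a, b, hab, hne⟩ := this
    rw [Matrix.det_zero_of_column_eq hne, zero_mul]
    intro k; simp [hab]

lemma alt_sum_zero {R : Type*} [CommRing R] [Algebra ℂ R] {κ : Type*} [Fintype κ] [DecidableEq κ]
    (g : Perm κ → R) (p q : κ) (hpq : p ≠ q) (h : ∀ σ, g (σ * swap p q) = g σ) :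
    ∑ σ : Perm κ, ((Perm.sign σ : ℤ) : R) * g σ = 0 := by
  have h2 : ∑ σ : Perm κ, ((Perm.sign σ : ℤ) : R) * g σ
      = - ∑ σ : Perm κ, ((Perm.sign σ : ℤ) : R) * g σ := by
    conv_lhs => rw [← Equiv.sum_comp (Equiv.mulRight (swap p q))]
    rw [← Finset.sum_neg_distrib]
    refine Finset.sum_congr rfl fun σ _ => ?_
    simp [h, Perm.sign_swap hpq]
  have h3 : (2 : ℂ) • ∑ σ : Perm κ, ((Perm.sign σ : ℤ) : R) * g σ = 0 := by
    rw [two_smul]; nth_rewrite 1 [h2]; simp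
  simpa using h3

/-- the linear part -/
def PP {R : Type*} [CommRing R] {n : ℕ} (A : Matrix (Fin n × Fin 2) (Fin n × Fin 2) R)
    (w : Fin n × Fin 2 → R) (k : Fin n × Fin 2) : R :=
  ∑ j : Fin n, ∑ σ : Perm (Fin n × Fin 2), ((Perm.sign σ : ℤ) : R) *
    ((∏ i ∈ Finset.univ.erase j, A (σ (i, 0)) (σ (i, 1))) *
      ((if σ (j, 0) = k then w (σ (j, 1)) else 0) - (if σ (j, 1) = k then w (σ (j, 0)) else 0)))

lemma FF_rank {R : Type*} [CommRing R] [Algebra ℂ R] {n : ℕ}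
    (A : Matrix (Fin n × Fin 2) (Fin n × Fin 2) R)
    (u w : Fin n × Fin 2 → R) :
    FF (Matrix.of fun x y => A x y + (u x * w y - w x * u y)) = FF A + ∑ k, u k * PP A w k := by
  have hP : ∑ k, u k * PP A w k = ∑ j : Fin n, ∑ σ : Perm (Fin n × Fin 2), ((Perm.sign σ : ℤ) : R) *
    ((∏ i ∈ Finset.univ.erase j, A (σ (i, 0)) (σ (i, 1))) *
      (u (σ (j, 0)) * w (σ (j, 1)) - w (σ (j, 0)) * u (σ (j, 1)))) := by
    unfold PP
    simp_rw [Finset.mul_sum]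
    rw [Finset.sum_comm]
    refine Finset.sum_congr rfl fun j _ => ?_
    rw [Finset.sum_comm]
    refine Finset.sum_congr rfl fun σ _ => ?_
    simp only [mul_sub, mul_ite, mul_zero, Finset.sum_sub_distrib, Finset.sum_ite_eq, Finset.mem_univ, if_true]
    ring
  rw [hP]
  unfold FF
  simp only [Matrix.of_apply]
  simp_rw [Finset.prod_add, Finset.mul_sum]
  rw [Finset.sum_comm]
  set T : Finset (Fin n) → R := fun t => ∑ σ : Perm (Fin n × Fin 2), ((Perm.sign σ : ℤ) : R) *
    ((∏ i ∈ t, A (σ (i, 0)) (σ (i, 1))) * ∏ i ∈ univ \ t, (u (σ (i, 0)) * w (σ (i, 1)) - w (σ (i, 0)) * u (σ (i, 1)))) with hT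
  change ∑ t ∈ (univ : Finset (Fin n)).powerset, T t = _
  have hz : ∀ t : Finset (Fin n), ∀ i j, i ∉ t → j ∉ t → i ≠ j → T t = 0 := by
    intro t i j hi hj hij
    have hD : ∀ σ : Perm (Fin n × Fin 2), ∏ i ∈ univ \ t, (u (σ (i, 0)) * w (σ (i, 1)) - w (σ (i, 0)) * u (σ (i, 1)))
       = (u (σ (i, 0)) * w (σ (i, 1)) - w (σ (i, 0)) * u (σ (i, 1))) *
         (u (σ (j, 0)) * w (σ (j, 1)) - w (σ (j, 0)) * u (σ (j, 1))) *
         ∏ i ∈ ((univ \ t).erase i).erase j, (u (σ (i, 0)) * w (σ (i, 1)) - w (σ (i, 0)) * u (σ (i, 1))) := by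
      intro σ
      rw [← Finset.mul_prod_erase (univ \ t) _ (a := i) (by simp [hi]),
        ← Finset.mul_prod_erase ((univ \ t).erase i) _ (a := j) (by simp [hj, hij.symm]), mul_assoc]
    set Z : Perm (Fin n × Fin 2) → R := fun σ => (∏ i ∈ t, A (σ (i, 0)) (σ (i, 1))) *
      ∏ i ∈ ((univ \ t).erase i).erase j, (u (σ (i, 0)) * w (σ (i, 1)) - w (σ (i, 0)) * u (σ (i, 1))) with hZ
    have hZs : ∀ (a b : Fin 2) σ, Z (σ * swap (i, a) (j, b)) = Z σ := by
      intro a b σ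
      have hne : ∀ k (c : Fin 2), k ≠ i → k ≠ j → (σ * swap (i, a) (j, b)) (k, c) = σ (k, c) := by
        intro k c h1 h2
        rw [Perm.mul_apply, swap_apply_of_ne_of_ne] <;> simp [h1, h2]
      simp only [hZ]
      congr 1
      · refine Finset.prod_congr rfl fun k hk => ?_
        have h1 : k ≠ i := by rintro rfl; exact hi hk
        have h2 : k ≠ j := by rintro rfl; exact hj hk
        rw [hne k 0 h1 h2, hne k 1 h1 h2]
      · refine Finset.prod_congr rfl fun k hk => ?_
        simp only [Finset.mem_erase] at hk
        have h1 : k ≠ i := hk.2.1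
        have h2 : k ≠ j := hk.1
        rw [hne k 0 h1 h2, hne k 1 h1 h2]
    have e1 : T t = ∑ σ : Perm (Fin n × Fin 2), ((Perm.sign σ : ℤ) : R) * (u (σ (i, 0)) * w (σ (i, 1)) * u (σ (j, 0)) * w (σ (j, 1)) * Z σ)
      - ∑ σ : Perm (Fin n × Fin 2), ((Perm.sign σ : ℤ) : R) * (u (σ (i, 0)) * w (σ (i, 1)) * w (σ (j, 0)) * u (σ (j, 1)) * Z σ)
      - ∑ σ : Perm (Fin n × Fin 2), ((Perm.sign σ : ℤ) : R) * (w (σ (i, 0)) * u (σ (i, 1)) * u (σ (j, 0)) * w (σ (j, 1)) * Z σ)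
      + ∑ σ : Perm (Fin n × Fin 2), ((Perm.sign σ : ℤ) : R) * (w (σ (i, 0)) * u (σ (i, 1)) * w (σ (j, 0)) * u (σ (j, 1)) * Z σ) := by
      rw [hT, ← Finset.sum_sub_distrib, ← Finset.sum_sub_distrib, ← Finset.sum_add_distrib]
      refine Finset.sum_congr rfl fun σ _ => ?_
      rw [hD, hZ]; ring
    have ne0 : ∀ a b : Fin 2, ((i, a) : Fin n × Fin 2) ≠ (j, b) := by
      intro a b h; exact hij (Prod.ext_iff.1 h).1
    have key : ∀ (a b a' b' : Fin 2), a ≠ a' → b ≠ b' → ∀ σ : Perm (Fin n × Fin 2),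
       (σ * swap (i, a) (j, b)) (i, a) = σ (j, b) ∧ (σ * swap (i, a) (j, b)) (j, b) = σ (i, a) ∧
       (σ * swap (i, a) (j, b)) (i, a') = σ (i, a') ∧ (σ * swap (i, a) (j, b)) (j, b') = σ (j, b') := by
      intro a b a' b' h1 h2 σ
      refine ⟨by simp, by simp, ?_, ?_⟩
      · rw [Perm.mul_apply, swap_apply_of_ne_of_ne] <;> simp [h1.symm, hij]
      · rw [Perm.mul_apply, swap_apply_of_ne_of_ne] <;> simp [h2.symm, hij.symm]
    rw [e1, alt_sum_zero _ (i, 1) (j, 1) (ne0 _ _), alt_sum_zero _ (i, 1) (j, 0) (ne0 _ _),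
      alt_sum_zero _ (i, 0) (j, 1) (ne0 _ _), alt_sum_zero _ (i, 0) (j, 0) (ne0 _ _)]
    · simp
    · intro σ
      obtain ⟨k1, k2, k3, k4⟩ := key 0 0 1 1 (by decide) (by decide) σ
      rw [k1, k2, k3, k4, hZs]; ring
    · intro σ
      obtain ⟨k1, k2, k3, k4⟩ := key 0 1 1 0 (by decide) (by decide) σ
      rw [k1, k2, k3, k4, hZs]; ring
    · intro σ
      obtain ⟨k1, k2, k3, k4⟩ := key 1 0 0 1 (by decide) (by decide) σ
      rw [k1, k2, k3, k4, hZs]; ring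
    · intro σ
      obtain ⟨k1, k2, k3, k4⟩ := key 1 1 0 0 (by decide) (by decide) σ
      rw [k1, k2, k3, k4, hZs]; ring
  have hne : (univ : Finset (Fin n)) ∉ (univ : Finset (Fin n)).image (fun j => univ.erase j) := by
    intro h
    obtain ⟨x, -, hx⟩ := Finset.mem_image.1 h
    have : x ∈ univ.erase x := by rw [hx]; simp
    simp at this
  rw [Finset.powerset_univ, ← Finset.sum_subset (Finset.subset_univ (insert univ (univ.image (fun j : Fin n => univ.erase j))))]
  · rw [Finset.sum_insert hne, Finset.sum_image]
    · congr 1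
      · simp [hT]
      · refine Finset.sum_congr rfl fun j _ => ?_
        simp only [hT]
        refine Finset.sum_congr rfl fun σ _ => ?_
        rw [show univ \ univ.erase j = {j} by ext; simp, Finset.prod_singleton]
    · intro a _ b _ hab
      by_contra hne
      have : a ∈ univ.erase b := by simp [hne]
      simp only at hab
      rw [← hab] at this
      simp at this
  · intro t _ ht
    simp only [Finset.mem_insert, Finset.mem_image, Finset.mem_univ, true_and, not_or, not_exists] at ht
    have : ∃ i, i ∉ t := by
      by_contra h; push Not at h; exact ht.1 (Finset.eq_univ_iff_forall.2 h)
    obtain ⟨i, hi⟩ := this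
    have : ∃ j, j ∉ t ∧ i ≠ j := by
      by_contra h
      push Not at h
      apply ht.2 i
      ext j
      simp only [Finset.mem_erase, Finset.mem_univ, and_true]
      constructor
      · intro hj; by_contra hjt; exact hj (h j hjt).symm
      · rintro hj rfl; exact hi hj
    obtain ⟨j, hj, hij⟩ := this
    exact hz t i j hi hj hij

lemma PP_self {R : Type*} [CommRing R] [Algebra ℂ R] {n : ℕ}
    (A : Matrix (Fin n × Fin 2) (Fin n × Fin 2) R) (w : Fin n × Fin 2 → R) :
    ∑ k, w k * PP A w k = 0 := by
  have := FF_rank A w w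
  have h : (Matrix.of fun x y => A x y + (w x * w y - w x * w y)) = A := by ext; simp
  rw [h] at this
  simpa using this

lemma PP_mul {R : Type*} [CommRing R] [Algebra ℂ R] {n : ℕ}
    (A : Matrix (Fin n × Fin 2) (Fin n × Fin 2) R) (w : Fin n × Fin 2 → R)
    (hA : ∀ i j, A j i = - A i j) (i : Fin n × Fin 2) :
    ∑ k, A i k * PP A w k = - (w i * FF A) := by
  have hii : A i i = 0 := by
    have h := hA i i
    have h3 : (2 : ℂ) • A i i = 0 := by
      rw [two_smul]; nth_rewrite 1 [h]; simp
    simpa using h3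
  have h1 := FF_rank A (fun k => - A i k) w
  have h2 := FF_congr A (1 + Matrix.replicateCol Unit w * Matrix.replicateRow Unit (Pi.single i (1 : R)))
  rw [Matrix.det_one_add_replicateCol_mul_replicateRow] at h2
  have h3 : (Matrix.of fun x y => A x y + (-A i x * w y - w x * -A i y)) =
    (1 + Matrix.replicateCol Unit w * Matrix.replicateRow Unit (Pi.single i (1 : R))) * A *
      (1 + Matrix.replicateCol Unit w * Matrix.replicateRow Unit (Pi.single i (1 : R))).transpose := by
    rw [Matrix.transpose_add, Matrix.transpose_mul, Matrix.add_mul, Matrix.mul_add,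
      Matrix.transpose_one, Matrix.mul_one, Matrix.one_mul, Matrix.add_mul]
    ext x y
    simp [Matrix.mul_apply, Pi.single_apply, hii, hA i x]
    ring
  rw [h3, h2] at h1
  simp at h1
  linear_combination h1

end

noncomputable section
open Equiv Finset

def pairPerm {n : ℕ} (h : Perm (Fin n) × (Fin n → Perm (Fin 2))) : Perm (Fin n × Fin 2) :=
  (prodCongrRight h.2) * (prodCongrLeft (fun _ : Fin 2 => h.1))

lemma pairPerm_apply {n : ℕ} (h : Perm (Fin n) × (Fin n → Perm (Fin 2))) (i : Fin n) (j : Fin 2) :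
    pairPerm h (i, j) = (h.1 i, h.2 (h.1 i) j) := rfl

lemma sign_pairPerm {n : ℕ} (h : Perm (Fin n) × (Fin n → Perm (Fin 2))) :
    Perm.sign (pairPerm h) = ∏ k, Perm.sign (h.2 k) := by
  unfold pairPerm
  rw [Perm.sign_mul, Perm.sign_prodCongrRight, Perm.sign_prodCongrLeft]
  simp

def termF {R : Type*} [CommRing R] {n : ℕ} (A : Matrix (Fin n × Fin 2) (Fin n × Fin 2) R)
    (σ : Perm (Fin n × Fin 2)) : R := ((Perm.sign σ : ℤ) : R) * ∏ i, A (σ (i, 0)) (σ (i, 1))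

lemma termF_mul {R : Type*} [CommRing R] {n : ℕ} (A : Matrix (Fin n × Fin 2) (Fin n × Fin 2) R)
    (hA : ∀ i j, A j i = - A i j) (σ : Perm (Fin n × Fin 2))
    (h : Perm (Fin n) × (Fin n → Perm (Fin 2))) : termF A (σ * pairPerm h) = termF A σ := by
  unfold termF
  rw [Perm.sign_mul, sign_pairPerm]
  have h1 : ∏ i, A ((σ * pairPerm h) (i, 0)) ((σ * pairPerm h) (i, 1)) =
      ∏ i, A (σ (i, h.2 i 0)) (σ (i, h.2 i 1)) := by
    simp only [Perm.mul_apply, pairPerm_apply]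
    exact Equiv.prod_comp h.1 (fun i => A (σ (i, h.2 i 0)) (σ (i, h.2 i 1)))
  have h2 : ∀ i, A (σ (i, h.2 i 0)) (σ (i, h.2 i 1)) =
      ((Perm.sign (h.2 i) : ℤ) : R) * A (σ (i, 0)) (σ (i, 1)) := by
    intro i
    generalize h.2 i = p
    have : p = 1 ∨ p = swap 0 1 := by revert p; decide
    rcases this with rfl | rfl
    · simp
    · simp [hA (σ (i, 0)) (σ (i, 1))]
  rw [h1]
  simp_rw [h2]
  rw [Finset.prod_mul_distrib]
  have h3 : (∏ i, ((Perm.sign (h.2 i) : ℤ) : R)) * (∏ i, ((Perm.sign (h.2 i) : ℤ) : R)) = 1 := by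
    rw [← Finset.prod_mul_distrib]
    apply Finset.prod_eq_one
    intro i _
    rw [← Int.cast_mul, ← Units.val_mul]
    simp
  have h4 : (((Perm.sign σ * ∏ k, Perm.sign (h.2 k) : ℤˣ) : ℤ) : R) =
      ((Perm.sign σ : ℤ) : R) * ∏ i, ((Perm.sign (h.2 i) : ℤ) : R) := by
    rw [Units.val_mul, Int.cast_mul, Units.coe_prod, Int.cast_prod]
  rw [h4]
  linear_combination (((Perm.sign σ : ℤ) : R) * ∏ i, A (σ (i, 0)) (σ (i, 1))) * h3

def condF {n : ℕ} {L : Type*} [LinearOrder L] (f : Fin n × Fin 2 → L) : Prop :=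
  (∀ i, f (i, 0) < f (i, 1)) ∧ StrictMono (fun i => f (i, 0))

lemma condF_unique {n : ℕ} {L : Type*} [LinearOrder L] (f : Fin n × Fin 2 → L)
    (hf : Function.Injective f) :
    ∃! h : Perm (Fin n) × (Fin n → Perm (Fin 2)), condF (f ∘ pairPerm h) := by
  have hne : ∀ k, f (k, 0) ≠ f (k, 1) := fun k h => by simpa using hf h
  let ε : Fin n → Perm (Fin 2) := fun k => if f (k, 0) < f (k, 1) then 1 else swap 0 1
  have hε : ∀ k, f (k, ε k 0) < f (k, ε k 1) := by
    intro k
    simp only [ε]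
    split_ifs with h
    · simpa using h
    · simpa using lt_of_le_of_ne (not_lt.1 h) (hne k).symm
  have hεu : ∀ k (p : Perm (Fin 2)), f (k, p 0) < f (k, p 1) → p = ε k := by
    intro k p hp
    have h1 : p = 1 ∨ p = swap 0 1 := by clear hp; revert p; decide
    simp only [ε]
    rcases h1 with rfl | rfl
    · rw [if_pos (by simpa using hp)]
    · rw [if_neg (by simpa using hp.le)]
  let m : Fin n → L := fun k => f (k, ε k 0)
  have hm : Function.Injective m := by
    intro a b hab
    exact (Prod.ext_iff.1 (hf hab)).1
  refine ⟨(Tuple.sort m, ε), ⟨?_, ?_⟩, ?_⟩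
  · intro i
    exact hε _
  · have h1 := Tuple.monotone_sort m
    exact h1.strictMono_of_injective (hm.comp (Tuple.sort m).injective)
  · rintro ⟨π, p⟩ ⟨h1, h2⟩
    have hp : p = ε := by
      funext k
      apply hεu
      have := h1 (π.symm k)
      simpa [pairPerm_apply] using this
    subst hp
    have h3 := Tuple.unique_monotone (f := m) (σ := π) (τ := Tuple.sort m) h2.monotone (Tuple.monotone_sort m)
    have : π = Tuple.sort m := by
      ext i
      exact congrArg _ (hm (congrFun h3 i))
    rw [this]

def eIdx (n : ℕ) : Fin n × Fin 2 ≃ Fin (2 * n) :=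
  finProdFinEquiv.trans (finCongr (mul_comm n 2))

lemma eIdx_zero {n : ℕ} (i : Fin n) (h) : (⟨2 * i.val, h⟩ : Fin (2 * n)) = eIdx n (i, 0) := by
  ext; simp [eIdx]

lemma eIdx_one {n : ℕ} (i : Fin n) (h) : (⟨2 * i.val + 1, h⟩ : Fin (2 * n)) = eIdx n (i, 1) := by
  ext; simp [eIdx]; omega

open scoped Classical in
lemma pfaffian_eq {R : Type*} [CommRing R] {n : ℕ} (A : Matrix (Fin (2 * n)) (Fin (2 * n)) R) :
    pfaffian A = ∑ ρ : Perm (Fin n × Fin 2),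
      if condF (eIdx n ∘ ρ) then termF (A.submatrix (eIdx n) (eIdx n)) ρ else 0 := by
  unfold pfaffian
  rw [← Equiv.sum_comp (eIdx n).permCongr]
  refine Finset.sum_congr rfl fun ρ _ => ?_
  have hn : 2 * n / 2 = n := by omega
  have hc : pfaffianCond ((eIdx n).permCongr ρ) ↔ condF (eIdx n ∘ ρ) := by
    unfold pfaffianCond condF
    constructor
    · rintro ⟨h1, h2⟩
      constructor
      · intro i
        have := h1 (Fin.cast hn.symm i)
        simp only [Fin.val_cast, eIdx_zero, eIdx_one] at this
        simpa using this
      · intro i j hij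
        have := h2 (Fin.cast hn.symm i) (Fin.cast hn.symm j) hij
        simp only [Fin.val_cast, eIdx_zero] at this
        simpa using this
    · rintro ⟨h1, h2⟩
      constructor
      · intro i
        have := h1 (Fin.cast hn i)
        have e0 := eIdx_zero (Fin.cast hn i) (by have := i.isLt; simp only [Fin.val_cast]; omega)
        have e1 := eIdx_one (Fin.cast hn i) (by have := i.isLt; simp only [Fin.val_cast]; omega)
        simp only [Fin.val_cast] at e0 e1
        rw [e0, e1]
        simpa using this
      · intro i j hij
        have := h2 (show Fin.cast hn i < Fin.cast hn j from hij)
        have e0 := eIdx_zero (Fin.cast hn i) (by have := i.isLt; simp only [Fin.val_cast]; omega)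
        have e1 := eIdx_zero (Fin.cast hn j) (by have := j.isLt; simp only [Fin.val_cast]; omega)
        simp only [Fin.val_cast] at e0 e1
        rw [e0, e1]
        simpa using this
  by_cases hcc : condF (eIdx n ∘ ρ)
  · rw [if_pos hcc, if_pos (hc.2 hcc)]
    unfold termF
    rw [Perm.sign_permCongr, zsmul_eq_mul]
    congr 1
    refine Fintype.prod_equiv (finCongr hn) _ _ ?_
    intro i
    have e0 := eIdx_zero (Fin.cast hn i) (by have := i.isLt; simp only [Fin.val_cast]; omega)
    have e1 := eIdx_one (Fin.cast hn i) (by have := i.isLt; simp only [Fin.val_cast]; omega)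
    simp only [Fin.val_cast] at e0 e1
    rw [e0, e1]
    simp
  · rw [if_neg hcc, if_neg (fun h => hcc (hc.1 h))]

lemma card_pfaffian {R : Type*} [CommRing R] {n : ℕ} (A : Matrix (Fin (2 * n)) (Fin (2 * n)) R)
    (hA : ∀ i j, A j i = - A i j) :
    (Fintype.card (Perm (Fin n) × (Fin n → Perm (Fin 2))) : R) * pfaffian A =
      FF (A.submatrix (eIdx n) (eIdx n)) := by
  classical
  set A' := A.submatrix (eIdx n) (eIdx n) with hA'
  have hs : ∀ i j, A' j i = - A' i j := fun i j => hA _ _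
  have h1 : ∀ h : Perm (Fin n) × (Fin n → Perm (Fin 2)), pfaffian A =
      ∑ ρ : Perm (Fin n × Fin 2), if condF (eIdx n ∘ (ρ * pairPerm h : Perm _)) then termF A' ρ else 0 := by
    intro h
    rw [pfaffian_eq, ← Equiv.sum_comp (Equiv.mulRight (pairPerm h))]
    refine Finset.sum_congr rfl fun ρ _ => ?_
    simp only [Equiv.coe_mulRight]
    rw [termF_mul _ hs]
    split_ifs with hc
    · exact if_pos hc
    · exact if_neg hc
  have h2 : ∑ h : Perm (Fin n) × (Fin n → Perm (Fin 2)), pfaffian A = FF A' := by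
    rw [Finset.sum_congr rfl fun h _ => h1 h, Finset.sum_comm]
    unfold FF
    refine Finset.sum_congr rfl fun ρ _ => ?_
    obtain ⟨h0, hh, hu⟩ := condF_unique (eIdx n ∘ ρ) ((eIdx n).injective.comp ρ.injective)
    rw [Finset.sum_eq_single h0]
    · rw [if_pos]
      · rfl
      · exact hh
    · intro h _ hne
      rw [if_neg]
      intro hc
      exact hne (hu h hc)
    · simp
  rw [← h2]
  simp

lemma pfaffian_map {R S : Type*} [CommRing R] [CommRing S] (f : R →+* S) {m : ℕ}
    (A : Matrix (Fin m) (Fin m) R) : f (pfaffian A) = pfaffian (A.map f) := by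
  unfold pfaffian
  rw [map_sum]
  refine Finset.sum_congr rfl fun σ _ => ?_
  split_ifs
  · rw [map_zsmul, map_prod]; rfl
  · simp

/-- Main Pfaffian facts. -/
lemma exists_P {R : Type*} [CommRing R] [Algebra ℂ R] {n : ℕ}
    (A : Matrix (Fin (2 * n)) (Fin (2 * n)) R) (hA : ∀ i j, A j i = - A i j)
    (w : Fin (2 * n) → R) : ∃ P : Fin (2 * n) → R,
      (∑ k, w k * P k = 0) ∧ (∀ i, ∑ k, A i k * P k = - (w i * pfaffian A)) ∧
      (∀ (S : Type) [CommRing S] [Algebra ℂ S] (f : R →+* S) (u : Fin (2 * n) → S),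
        pfaffian (Matrix.of fun x y => f (A x y) + (u x * f (w y) - f (w x) * u y)) =
          f (pfaffian A) + ∑ k, u k * f (P k)) := by
  set K : ℕ := Fintype.card (Perm (Fin n) × (Fin n → Perm (Fin 2))) with hK
  have hK0 : (K : ℂ) ≠ 0 := by
    rw [Nat.cast_ne_zero]; exact Fintype.card_ne_zero
  have hinv : ∀ (S : Type _) [CommRing S] [Algebra ℂ S], algebraMap ℂ S (K : ℂ)⁻¹ * (K : S) = 1 := by
    intro S _ _
    rw [← map_natCast (algebraMap ℂ S) K, ← map_mul, inv_mul_cancel₀ hK0, map_one]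
  set e := eIdx n
  set A' := A.submatrix e e with hA'
  have hs : ∀ i j, A' j i = - A' i j := fun i j => hA _ _
  have hkp := card_pfaffian A hA
  have iR := hinv R
  refine ⟨fun k => algebraMap ℂ R (K : ℂ)⁻¹ * PP A' (w ∘ e) (e.symm k), ?_, ?_, ?_⟩
  · rw [← Equiv.sum_comp e]
    have := PP_self A' (w ∘ e)
    simp only [Equiv.symm_apply_apply, mul_left_comm (w _), ← Finset.mul_sum]
    simp only [Function.comp_apply] at this
    rw [this, mul_zero]
  · intro i
    rw [← Equiv.sum_comp e]
    have := PP_mul A' (w ∘ e) hs (e.symm i)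
    simp only [Equiv.symm_apply_apply, mul_left_comm (A _ _), ← Finset.mul_sum]
    simp only [Function.comp_apply, hA', Matrix.submatrix_apply, Equiv.apply_symm_apply] at this
    rw [this, ← hkp]
    linear_combination (- w i * pfaffian A) * iR
  · intro S _ _ f u
    have iS : f (algebraMap ℂ R (K : ℂ)⁻¹) * (K : S) = 1 := by
      rw [← map_natCast f K, ← map_mul, iR, map_one]
    have h1 := card_pfaffian (Matrix.of fun x y => f (A x y) + (u x * f (w y) - f (w x) * u y))
      (by intro i j; simp only [Matrix.of_apply]; rw [hA i j, map_neg]; ring)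
    have h2 := FF_rank (A'.map f) (u ∘ e) (f ∘ w ∘ e)
    have h3 : ∀ k, PP (A'.map f) (f ∘ w ∘ e) k = f (PP A' (w ∘ e) k) := by
      intro k
      unfold PP
      simp only [map_sum, map_mul, map_prod, map_sub, map_intCast, apply_ite f, map_zero]
      rfl
    have h4 : FF (A'.map f) = f (FF A') := by
      unfold FF
      simp only [map_sum, map_mul, map_prod, map_intCast]
      rfl
    simp_rw [h3] at h2
    rw [h4, ← hkp] at h2
    have h5 : (Matrix.of fun x y => f (A x y) + (u x * f (w y) - f (w x) * u y)).submatrix e e =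
      (Matrix.of fun x y => (A'.map f) x y + ((u ∘ e) x * (f ∘ w ∘ e) y - (f ∘ w ∘ e) x * (u ∘ e) y)) := rfl
    rw [h5, h2] at h1
    rw [← Equiv.sum_comp e]
    simp only [Equiv.symm_apply_apply, map_mul, mul_left_comm (u _), ← Finset.mul_sum]
    simp only [Function.comp_apply, map_mul, map_natCast] at h1
    rw [← hK] at h1
    linear_combination (f (algebraMap ℂ R (K : ℂ)⁻¹)) * h1 + (f (pfaffian A) - pfaffian (Matrix.of fun x y => f (A x y) + (u x * f (w y) - f (w x) * u y))) * iS

end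

noncomputable section
open Finset

def SS {R : Type*} [CommRing R] [Algebra ℂ R] (n : ℕ) (c : ℕ → R) : R :=
  MvPolynomial.aeval c (schurPoly n)

section SSsec
variable {R : Type*} [CommRing R] [Algebra ℂ R]

lemma SS_zero_idx (c : ℕ → R) : SS 0 c = 1 := by simp [SS, schurPoly]

lemma SS_succ (n : ℕ) (c : ℕ → R) : ((n + 1 : ℂ)) • SS (n + 1) c =
    ∑ j ∈ range (n + 1), ((j + 1 : ℂ)) • (c (j + 1) * SS (n - j) c) := by
  have h : (n + 1 : ℂ) ≠ 0 := by exact_mod_cast Nat.succ_ne_zero n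
  unfold SS
  rw [schurPoly, map_smul, smul_smul, mul_inv_cancel₀ h, one_smul, map_sum]
  refine Finset.sum_congr rfl fun j _ => ?_
  rw [map_smul, map_mul, MvPolynomial.aeval_X]

lemma SS_unique (c : ℕ → R) (f : ℕ → R) (h0 : f 0 = 1)
    (h : ∀ n : ℕ, ((n : ℂ) + 1) • f (n + 1) =
      ∑ j ∈ range (n + 1), ((j + 1 : ℂ)) • (c (j + 1) * f (n - j))) (n : ℕ) : f n = SS n c := by
  induction n using Nat.strong_induction_on with
  | _ n ih =>
    rcases n with _ | n
    · rw [h0, SS_zero_idx]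
    · have hn : (n + 1 : ℂ) ≠ 0 := by exact_mod_cast Nat.succ_ne_zero n
      apply smul_right_injective R hn
      simp only
      rw [h, SS_succ]
      refine Finset.sum_congr rfl fun j _ => ?_
      rw [ih (n - j) (by omega)]

lemma SS_add (c d : ℕ → R) (n : ℕ) :
    SS n (fun j => c j + d j) = ∑ k ∈ range (n + 1), SS k c * SS (n - k) d := by
  symm
  have hder : ∀ e : ℕ → R, PowerSeries.derivative R (PowerSeries.mk fun n => SS n e) =
      (PowerSeries.mk fun j => (j + 1 : ℂ) • e (j + 1)) * PowerSeries.mk fun n => SS n e := by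
    intro e
    ext n
    rw [PowerSeries.coeff_derivative, PowerSeries.coeff_mul, PowerSeries.coeff_mk,
      Finset.Nat.sum_antidiagonal_eq_sum_range_succ_mk]
    simp only [PowerSeries.coeff_mk, smul_mul_assoc]
    rw [← SS_succ, Algebra.smul_def]
    simp [mul_comm]
  set G := (PowerSeries.mk fun n => SS n c) * (PowerSeries.mk fun n => SS n d) with hG
  have hGc : ∀ n, PowerSeries.coeff n G = ∑ k ∈ range (n + 1), SS k c * SS (n - k) d := by
    intro n
    rw [hG, PowerSeries.coeff_mul, Finset.Nat.sum_antidiagonal_eq_sum_range_succ_mk]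
    simp
  have hGd : PowerSeries.derivative R G =
      (PowerSeries.mk fun j => (j + 1 : ℂ) • (c (j + 1) + d (j + 1))) * G := by
    have : (PowerSeries.mk fun j => (j + 1 : ℂ) • (c (j + 1) + d (j + 1))) =
      (PowerSeries.mk fun j => (j + 1 : ℂ) • c (j + 1)) + PowerSeries.mk fun j => (j + 1 : ℂ) • d (j + 1) := by
      ext; simp
    rw [this, hG, Derivation.leibniz, hder, hder, smul_eq_mul, smul_eq_mul]
    ring
  rw [← hGc]
  refine SS_unique (fun j => c j + d j) (fun n => PowerSeries.coeff n G) ?_ ?_ n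
  · rw [hGc]; simp [SS_zero_idx]
  · intro n
    have h1 := congrArg (PowerSeries.coeff n) hGd
    rw [PowerSeries.coeff_derivative, PowerSeries.coeff_mul (φ := PowerSeries.mk _) (ψ := G),
      Finset.Nat.sum_antidiagonal_eq_sum_range_succ_mk] at h1
    simp only [PowerSeries.coeff_mk, smul_mul_assoc] at h1
    rw [← h1, Algebra.smul_def]
    simp [mul_comm]

lemma SS_parity (c : ℕ → R) (n : ℕ) : SS n (fun j => (-1) ^ j * c j) = (-1) ^ n * SS n c := by
  symm
  refine SS_unique (fun j => (-1) ^ j * c j) (fun n => (-1) ^ n * SS n c) ?_ ?_ n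
  · simp [SS_zero_idx]
  · intro n
    rw [← mul_smul_comm, SS_succ, Finset.mul_sum]
    refine Finset.sum_congr rfl fun j hj => ?_
    rw [mul_smul_comm]
    congr 1
    have : n + 1 = (j + 1) + (n - j) := by simp at hj; omega
    rw [this, pow_add]; 
    ring

lemma SS_const_zero (n : ℕ) : SS n (fun _ => (0 : R)) = if n = 0 then 1 else 0 := by
  symm
  refine SS_unique (fun _ => (0 : R)) (fun n => if n = 0 then 1 else 0) (by simp) ?_ n
  intro n; simp

lemma SS_map {S : Type*} [CommRing S] [Algebra ℂ S] (f : R →ₐ[ℂ] S) (n : ℕ) (c : ℕ → R) :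
    f (SS n c) = SS n (fun j => f (c j)) := by
  unfold SS
  rw [← AlgHom.comp_apply, MvPolynomial.comp_aeval]

/-- exponent sequence of `(1 - x z)/(1 + x z)` -/
def dx (x : R) : ℕ → R := fun j => if j % 2 = 1 then (-(2 / (j : ℂ))) • x ^ j else 0

def hh (x : R) : ℕ → R := fun n => if n = 0 then 1 else 2 * (-x) ^ n

lemma hh_rec (x : R) (n : ℕ) : ∑ j ∈ range (n + 1), (if j % 2 = 0 then x ^ (j + 1) * hh x (n - j) else 0)
    = if n % 2 = 0 then (n + 1 : ℂ) • x ^ (n + 1) else -((n + 1 : ℂ) • x ^ (n + 1)) := by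
  induction n using Nat.strong_induction_on with
  | _ n ih =>
    match n with
    | 0 => simp [hh]
    | 1 =>
      have h2 : algebraMap ℂ R 2 = 2 := map_ofNat _ 2
      rw [Finset.sum_range_succ, Finset.sum_range_one, Algebra.smul_def]
      simp [hh, one_add_one_eq_two, h2]
      ring
    | n + 2 =>
      rw [Finset.sum_range_succ', Finset.sum_range_succ']
      have h1 : ∀ j ∈ range (n + 1), (if (j + 1 + 1) % 2 = 0 then x ^ (j + 1 + 1 + 1) * hh x (n + 2 - (j + 1 + 1)) else 0)
         = x ^ 2 * (if j % 2 = 0 then x ^ (j + 1) * hh x (n - j) else 0) := by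
        intro j _
        rw [show (j + 1 + 1) % 2 = j % 2 by omega, show n + 2 - (j + 1 + 1) = n - j by omega]
        split_ifs
        · ring
        · simp
      rw [Finset.sum_congr rfl h1, ← Finset.mul_sum, ih n (by omega)]
      rw [show (n + 2) % 2 = n % 2 by omega]
      have h2 : hh x (n + 2) = 2 * (-x) ^ (n + 2) := by simp [hh]
      have h3 : algebraMap ℂ R 2 = 2 := map_ofNat _ 2
      simp only [Algebra.smul_def]
      by_cases hn : n % 2 = 0
      · have he : Even n := Nat.even_iff.2 hn
        simp [hn, h2, h3, (he.add (even_two)).neg_pow]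
        ring
      · have he : Odd n := Nat.odd_iff.2 (by omega)
        simp [hn, h2, h3, (he.add_even (even_two)).neg_pow]
        ring

lemma SS_dx (x : R) (n : ℕ) : SS n (dx x) = hh x n := by
  symm
  refine SS_unique (dx x) (hh x) (by simp [hh]) ?_ n
  intro n
  have h1 : ∀ j ∈ range (n + 1), (j + 1 : ℂ) • (dx x (j + 1) * hh x (n - j)) =
      (-2 : ℂ) • (if j % 2 = 0 then x ^ (j + 1) * hh x (n - j) else 0) := by
    intro j _
    have hj : (j + 1 : ℂ) ≠ 0 := by exact_mod_cast Nat.succ_ne_zero j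
    unfold dx
    by_cases h : j % 2 = 0
    · rw [if_pos (by omega), if_pos h, smul_mul_assoc, smul_smul]
      congr 1
      push_cast
      field_simp
    · rw [if_neg (by omega), if_neg h]; simp
  rw [Finset.sum_congr rfl h1, ← Finset.smul_sum, hh_rec]
  simp only [hh, Nat.succ_ne_zero, if_false, Algebra.smul_def]
  have h3 : algebraMap ℂ R 2 = 2 := map_ofNat _ 2
  by_cases hn : n % 2 = 0
  · have he : Even n := Nat.even_iff.2 hn
    rw [if_pos hn, he.add_one.neg_pow]
    simp [h3]; ring
  · have he : Odd n := Nat.odd_iff.2 (by omega)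
    rw [if_neg hn, he.add_one.neg_pow]
    simp [h3]; ring

end SSsec

section gamma
variable {R : Type*} [CommRing R]

def QQ (a b : ℕ → R) (l m : ℕ) : R :=
  ∑ k ∈ range m, (-1) ^ (k + 1) * (a (l + k + 1) * b (m - 1 - k))

lemma QQ_succ (a b : ℕ → R) (l m : ℕ) :
    QQ a b l (m + 1) = -(a (l + 1) * b m) - QQ a b (l + 1) m := by
  unfold QQ
  rw [Finset.sum_range_succ', add_comm, sub_eq_add_neg, ← Finset.sum_neg_distrib]
  congr 1
  · simp
  · refine Finset.sum_congr rfl fun k _ => ?_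
    rw [show l + (k + 1) + 1 = l + 1 + k + 1 by ring, show m + 1 - 1 - (k + 1) = m - 1 - k by omega]
    ring

def DD (a b' F : ℕ → R) (l m : ℕ) : R :=
  ∑ i ∈ range l, ∑ j ∈ range m, (-1) ^ (i + 1) * a (l - 1 - i) * b' (m - 1 - j) * F (i + j + 2)

lemma DD_rec (a b' F : ℕ → R) (l m : ℕ) :
    DD a b' F l (m + 1) + DD a b' F (l + 1) m =
      b' m * (∑ i ∈ range l, (-1) ^ (i + 1) * a (l - 1 - i) * F (i + 2))
      - a l * ∑ j ∈ range m, b' (m - 1 - j) * F (j + 2) := by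
  unfold DD
  rw [Finset.sum_range_succ' (n := l)]
  simp_rw [Finset.sum_range_succ' (n := m)]
  rw [Finset.sum_add_distrib]
  have h1 : ∑ i ∈ range l, ∑ j ∈ range m, (-1) ^ (i + 1) * a (l - 1 - i) * b' (m + 1 - 1 - (j + 1)) * F (i + (j + 1) + 2)
    = - ∑ i ∈ range l, ∑ j ∈ range m, (-1) ^ (i + 1 + 1) * a (l + 1 - 1 - (i + 1)) * b' (m - 1 - j) * F (i + 1 + j + 2) := by
    rw [← Finset.sum_neg_distrib]
    refine Finset.sum_congr rfl fun i _ => ?_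
    rw [← Finset.sum_neg_distrib]
    refine Finset.sum_congr rfl fun j _ => ?_
    rw [show m + 1 - 1 - (j + 1) = m - 1 - j by omega, show l + 1 - 1 - (i + 1) = l - 1 - i by omega,
      show i + (j + 1) + 2 = i + 1 + j + 2 by ring]
    ring
  rw [h1, Finset.mul_sum, Finset.mul_sum]
  have h2 : ∑ i ∈ range l, (-1) ^ (i + 1) * a (l - 1 - i) * b' (m + 1 - 1 - 0) * F (i + 0 + 2) =
    ∑ i ∈ range l, b' m * ((-1) ^ (i + 1) * a (l - 1 - i) * F (i + 2)) := by
    refine Finset.sum_congr rfl fun i _ => ?_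
    simp; ring
  have h3 : ∑ j ∈ range m, (-1) ^ (0 + 1) * a (l + 1 - 1 - 0) * b' (m - 1 - j) * F (0 + j + 2) =
    - ∑ j ∈ range m, a l * (b' (m - 1 - j) * F (j + 2)) := by
    rw [← Finset.sum_neg_distrib]
    refine Finset.sum_congr rfl fun j _ => ?_
    simp; ring
  rw [h2, h3]; ring

lemma DD_eq (a a' b b' F : ℕ → R) (F0 : F 0 = 1)
    (ha : ∀ n, a' n = ∑ k ∈ range (n + 1), (-1) ^ k * F k * a (n - k))
    (hb : ∀ n, b n = ∑ k ∈ range (n + 1), F k * b' (n - k)) (l m : ℕ) :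
    DD a b' F l m = a l * b' m - a l * b m + QQ a' b' l m - QQ a b l m := by
  induction m generalizing l with
  | zero =>
    have : b 0 = b' 0 := by rw [hb]; simp [F0]
    simp [DD, QQ, this]
  | succ m ih =>
    have h := DD_rec a b' F l m
    rw [ih] at h
    rw [QQ_succ, QQ_succ]
    have h1 : ∑ i ∈ range l, (-1) ^ (i + 1) * a (l - 1 - i) * F (i + 2) = a (l + 1) - F 1 * a l - a' (l + 1) := by
      rw [ha, Finset.sum_range_succ', Finset.sum_range_succ']
      have : ∑ k ∈ range l, (-1) ^ (k + 1 + 1) * F (k + 1 + 1) * a (l + 1 - (k + 1 + 1)) =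
        - ∑ i ∈ range l, (-1) ^ (i + 1) * a (l - 1 - i) * F (i + 2) := by
        rw [← Finset.sum_neg_distrib]
        refine Finset.sum_congr rfl fun i _ => ?_
        rw [show l + 1 - (i + 1 + 1) = l - 1 - i by omega]; ring
      rw [this]; simp [F0]; ring
    have h2 : ∑ j ∈ range m, b' (m - 1 - j) * F (j + 2) = b (m + 1) - F 1 * b' m - b' (m + 1) := by
      rw [hb, Finset.sum_range_succ', Finset.sum_range_succ']
      have : ∑ k ∈ range m, F (k + 1 + 1) * b' (m + 1 - (k + 1 + 1)) =
        ∑ j ∈ range m, b' (m - 1 - j) * F (j + 2) := by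
        refine Finset.sum_congr rfl fun i _ => ?_
        rw [show m + 1 - (i + 1 + 1) = m - 1 - i by omega]; ring
      rw [this]; simp [F0]; ring
    rw [h1, h2] at h
    linear_combination h

lemma GG_eq (a b : ℕ → R) (l m : ℕ) :
    QQ a b l m + QQ b a m l + a l * b m =
      (-1) ^ m * ∑ k ∈ range (l + m + 1), (-1) ^ k * b k * a (l + m - k) := by
  induction m generalizing l with
  | zero =>
    rw [Finset.sum_range_succ']
    have : ∑ k ∈ range l, (-1) ^ (k + 1) * b (k + 1) * a (l + 0 - (k + 1)) = QQ b a 0 l := by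
      unfold QQ
      refine Finset.sum_congr rfl fun k _ => ?_
      rw [show l + 0 - (k + 1) = l - 1 - k by omega, zero_add]; ring
    rw [this]
    simp [QQ, mul_comm]
  | succ m ih =>
    have h := ih (l + 1)
    rw [QQ_succ] at h
    rw [QQ_succ]
    rw [show l + 1 + m = l + (m + 1) by ring] at h
    rw [pow_succ]
    linear_combination -h

end gamma

end

noncomputable section
open Finset

section gamma2
variable {R : Type*} [CommRing R]

lemma QQ_map {S : Type*} [CommRing S] (f : R →+* S) (a b : ℕ → R) (l m : ℕ) :
    f (QQ a b l m) = QQ (fun n => f (a n)) (fun n => f (b n)) l m := by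
  simp [QQ]

lemma hh_diff (x : R) (a a' : ℕ → R)
    (ha : ∀ n, a' n = ∑ k ∈ range (n + 1), hh x k * a (n - k)) (l : ℕ) :
    a' l - a l = ∑ i ∈ range l, 2 * (-x) ^ (i + 1) * a (l - 1 - i) := by
  rw [ha, Finset.sum_range_succ']
  have : ∑ k ∈ range l, hh x (k + 1) * a (l - (k + 1)) =
      ∑ i ∈ range l, 2 * (-x) ^ (i + 1) * a (l - 1 - i) := by
    refine Finset.sum_congr rfl fun i _ => ?_
    rw [show l - (i + 1) = l - 1 - i by omega]
    simp [hh]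
  rw [this]
  simp [hh]

lemma hh_neg (x : R) (k : ℕ) : (-1) ^ k * hh (-x) k = hh x k := by
  unfold hh
  split_ifs with h
  · simp [h]
  · rw [neg_neg, neg_pow x]; ring

lemma QQ_diff (x : R) (a a' b b' : ℕ → R)
    (ha : ∀ n, a' n = ∑ k ∈ range (n + 1), hh x k * a (n - k))
    (hb : ∀ n, b n = ∑ k ∈ range (n + 1), hh (-x) k * b' (n - k)) (l m : ℕ) :
    2 * (QQ a' b' l m - QQ a b l m) = -((a' l + a l) * (b' m - b m)) := by
  have h := DD_eq a a' b b' (hh (-x)) (by simp [hh])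
    (fun n => by rw [ha]; exact Finset.sum_congr rfl fun k _ => by rw [hh_neg]) hb l m
  have h2 : 2 * DD a b' (hh (-x)) l m = (a' l - a l) * (b m - b' m) := by
    rw [hh_diff x a a' ha, hh_diff (-x) b' b hb, Finset.sum_mul_sum, DD, Finset.mul_sum]
    refine Finset.sum_congr rfl fun i _ => ?_
    rw [Finset.mul_sum]
    refine Finset.sum_congr rfl fun j _ => ?_
    have : hh (-x) (i + j + 2) = 2 * x ^ (i + j + 2) := by simp [hh]
    rw [this, neg_neg, neg_pow x]; ring
  linear_combination h2 - 2 * h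
end gamma2

/-- shift by `x` -/
def sh (x : Polynomial BRing) : BRing →ₐ[ℂ] Polynomial BRing :=
  MvPolynomial.aeval
    (fun i => Polynomial.C (MvPolynomial.X i) -
      Polynomial.C (MvPolynomial.C ((2 : ℂ) / ((2 * i + 1 : ℕ) : ℂ))) * x ^ (2 * i + 1))

lemma shiftMinus_eq (p : BRing) : shiftMinus p = sh Polynomial.X p := rfl

/-- negation (kept opaque for unification) -/
def ng {R : Type*} [CommRing R] (x : R) : R := -x

lemma ng_odd {R : Type*} [CommRing R] (a b x : R) (i : ℕ) :
    a + b * x ^ (2 * i + 1) = a - b * (ng x) ^ (2 * i + 1) := by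
  rw [ng, Odd.neg_pow ⟨i, rfl⟩]; ring

lemma shiftPlus_eq (p : BRing) : shiftPlus p = sh (ng Polynomial.X) p := by
  unfold shiftPlus sh
  congr 2
  funext i
  exact ng_odd _ _ _ _

lemma dx_neg {R : Type*} [CommRing R] [Algebra ℂ R] (x : R) (j : ℕ) : dx (ng x) j = - dx x j := by
  unfold dx ng
  split_ifs with h
  · rw [Odd.neg_pow (Nat.odd_iff.2 h), smul_neg]
  · simp

lemma sh_tShift (x : Polynomial BRing) (c : ℕ → ℂ) (j : ℕ) :
    sh x (tShift c j) = dx x j + Polynomial.C (tShift c j) := by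
  unfold tShift tTilde dx
  have hc : sh x (MvPolynomial.C (c j)) = Polynomial.C (MvPolynomial.C (c j)) := by
    exact (sh x).commutes (c j)
  rw [map_add, hc]
  split_ifs with h
  · have : 2 * ((j - 1) / 2) + 1 = j := by omega
    rw [sh, MvPolynomial.aeval_X, this, Algebra.smul_def]
    have h2 : algebraMap ℂ (Polynomial BRing) (-(2 / (j : ℂ))) =
      Polynomial.C (MvPolynomial.C (-(2 / (j : ℂ)))) := rfl
    rw [h2]
    simp only [map_neg, map_add]
    ring
  · simp

lemma sh_sB (x : Polynomial BRing) (c : ℕ → ℂ) (n : ℕ) :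
    sh x (sB n (tShift c)) =
      ∑ k ∈ range (n + 1), hh x k * Polynomial.C (sB (n - k) (tShift c)) := by
  change sh x (SS n (tShift c)) = _
  rw [SS_map]
  simp_rw [sh_tShift]
  rw [SS_add]
  refine Finset.sum_congr rfl fun k _ => ?_
  rw [SS_dx]
  exact congrArg (hh x k * ·) (SS_map (Polynomial.CAlgHom (R := ℂ) (A := BRing)) (n - k) (tShift c)).symm

lemma sh_sB_inv (x : Polynomial BRing) (c : ℕ → ℂ) (n : ℕ) :
    Polynomial.C (sB n (tShift c)) =
      ∑ k ∈ range (n + 1), hh (ng x) k * sh x (sB (n - k) (tShift c)) := by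
  have h0 : Polynomial.C (sB n (tShift c)) = SS n (fun j => Polynomial.C (tShift c j)) :=
    SS_map (Polynomial.CAlgHom (R := ℂ) (A := BRing)) n (tShift c)
  have : (fun j => Polynomial.C (tShift c j)) =
      fun j => dx (ng x) j + sh x (tShift c j) := by
    funext j
    rw [sh_tShift, dx_neg, neg_add_cancel_left]
  rw [h0, this, SS_add]
  refine Finset.sum_congr rfl fun k _ => ?_
  rw [SS_dx]
  exact congrArg (hh (ng x) k * ·) (SS_map (sh x) (n - k) (tShift c)).symm

lemma sqrt2_sq : 2 * (sqrt2⁻¹ * sqrt2⁻¹) = 1 := by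
  have : sqrt2 * sqrt2 = 2 := by
    unfold sqrt2
    rw [← Complex.ofReal_mul, Real.mul_self_sqrt (by norm_num)]; simp
  rw [← mul_inv, this]; norm_num

lemma sqrt2_sq_alg {R : Type*} [CommRing R] [Algebra ℂ R] :
    2 * (algebraMap ℂ R sqrt2⁻¹ * algebraMap ℂ R sqrt2⁻¹) = 1 := by
  have h := congrArg (algebraMap ℂ R) sqrt2_sq
  rw [map_mul, map_mul, map_one, map_ofNat] at h
  exact h

lemma rhoB_eq (l μ : ℕ) (c c' : ℕ → BRing) (b b' : ℂ) : rhoB l μ c c' b b' =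
    (algebraMap ℂ BRing sqrt2⁻¹ * sB l c - algebraMap ℂ BRing b) *
      (algebraMap ℂ BRing sqrt2⁻¹ * sB μ c' + algebraMap ℂ BRing b') +
      QQ (fun n => sB n c) (fun n => sB n c') l μ := by
  unfold rhoB QQ
  rw [Algebra.smul_def, Algebra.smul_def]
  congr 1
  rw [← Finset.Ico_add_one_right_eq_Icc, Finset.sum_Ico_eq_sum_range]
  refine Finset.sum_congr (by simp) fun k _ => ?_
  rw [show l + (1 + k) = l + k + 1 by ring, show μ - (1 + k) = μ - 1 - k by omega,
    Algebra.smul_def, map_pow, map_neg, map_one, add_comm 1 k]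

lemma rho1B_eq (l : ℕ) (c : ℕ → BRing) (b : ℂ) : rho1B l c b =
    algebraMap ℂ BRing sqrt2⁻¹ * sB l c + algebraMap ℂ BRing b := by
  unfold rho1B
  rw [Algebra.smul_def]; rfl

/-- the shift vectors -/
def uu (x : Polynomial BRing) (l : ℕ) (c : ℕ → ℂ) : Polynomial BRing :=
  algebraMap ℂ (Polynomial BRing) sqrt2⁻¹ *
    (sh x (sB l (tShift c)) - Polynomial.C (sB l (tShift c)))

lemma uu_eq (x : Polynomial BRing) (l : ℕ) (c : ℕ → ℂ) : uu x l c =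
    algebraMap ℂ (Polynomial BRing) sqrt2⁻¹ *
      ∑ i ∈ range l, 2 * (-x) ^ (i + 1) * Polynomial.C (sB (l - 1 - i) (tShift c)) := by
  unfold uu
  rw [hh_diff x (fun n => Polynomial.C (sB n (tShift c))) (fun n => sh x (sB n (tShift c)))
    (fun n => sh_sB x c n) l]

lemma C_algebraMap (z : ℂ) : Polynomial.C (algebraMap ℂ BRing z) =
    algebraMap ℂ (Polynomial BRing) z := rfl

lemma sh_rhoB (x : Polynomial BRing) (l μ : ℕ) (c c' : ℕ → ℂ) (b b' : ℂ) :
    sh x (rhoB l μ (tShift c) (tShift c') b b') =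
      Polynomial.C (rhoB l μ (tShift c) (tShift c') b b') +
      (uu x l c * Polynomial.C (rho1B μ (tShift c') b') -
        Polynomial.C (rho1B l (tShift c) b) * uu x μ c') := by
  have hQ := QQ_diff x (fun n => Polynomial.C (sB n (tShift c))) (fun n => sh x (sB n (tShift c)))
    (fun n => Polynomial.C (sB n (tShift c'))) (fun n => sh x (sB n (tShift c')))
    (fun n => sh_sB x c n) (fun n => sh_sB_inv x c' n) l μ
  have h1 := QQ_map (sh x).toRingHom (fun n => sB n (tShift c)) (fun n => sB n (tShift c')) l μ
  have h2 := QQ_map (Polynomial.C : BRing →+* _) (fun n => sB n (tShift c)) (fun n => sB n (tShift c')) l μ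
  simp only [AlgHom.toRingHom_eq_coe, RingHom.coe_coe] at h1
  rw [← h1, ← h2] at hQ
  rw [rhoB_eq, rho1B_eq, rho1B_eq]
  unfold uu
  simp only [map_add, map_mul, map_sub, AlgHom.commutes, C_algebraMap]
  have hr := sqrt2_sq_alg (R := Polynomial BRing)
  generalize algebraMap ℂ (Polynomial BRing) sqrt2⁻¹ = r at *
  generalize algebraMap ℂ (Polynomial BRing) b = β at *
  generalize algebraMap ℂ (Polynomial BRing) b' = β' at *
  generalize sh x (sB l (tShift c)) = a' at *
  generalize sh x (sB μ (tShift c')) = d' at *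
  generalize Polynomial.C (sB l (tShift c)) = a at *
  generalize Polynomial.C (sB μ (tShift c')) = d at *
  generalize sh x (QQ (R := BRing) _ _ _ _) = q' at *
  generalize Polynomial.C (QQ (R := BRing) _ _ _ _) = q at *
  linear_combination r * r * hQ - (q' - q) * hr

lemma sh_matrix (x : Polynomial BRing) {m : ℕ} (lam : Fin m → ℕ) (c : Fin m → ℕ → ℂ)
    (b : Fin m → ℂ) :
    (rhoMatrixEven lam c b).map (sh x) = Matrix.of fun i j =>
      Polynomial.C (rhoMatrixEven lam c b i j) +
       (uu x (lam i) (c i) * Polynomial.C (rho1B (lam j) (tShift (c j)) (b j)) -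
        Polynomial.C (rho1B (lam i) (tShift (c i)) (b i)) * uu x (lam j) (c j)) := by
  ext1 i j
  simp only [Matrix.map_apply, Matrix.of_apply, rhoMatrixEven, skewOf]
  split_ifs with h1 h2
  · exact sh_rhoB ..
  · rw [map_neg, sh_rhoB, map_neg]; ring
  · have : i = j := by omega
    subst this
    simp; ring

lemma rho_skew {m : ℕ} (lam : Fin m → ℕ) (c : Fin m → ℕ → ℂ)
    (b : Fin m → ℂ) (i j : Fin m) : rhoMatrixEven lam c b j i = - rhoMatrixEven lam c b i j := by
  simp only [rhoMatrixEven, skewOf, Matrix.of_apply]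
  split_ifs with h1 h2 <;> first | omega | simp

end

noncomputable section
open Finset

section phisec
variable {R : Type*} [CommRing R]

/-- linear functional `X^k ↦ F k` -/
def phi (F : ℕ → R) : Polynomial R →ₗ[R] R :=
  Polynomial.lsum fun k => (LinearMap.id : R →ₗ[R] R).smulRight (F k)

lemma phi_monomial (F : ℕ → R) (k : ℕ) (a : R) : phi F (Polynomial.monomial k a) = a * F k := by
  simp [phi, Polynomial.lsum_apply, Polynomial.sum_monomial_index]

lemma phi_CX (F : ℕ → R) (k : ℕ) (a : R) :
    phi F (Polynomial.C a * Polynomial.X ^ k) = a * F k := by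
  rw [Polynomial.C_mul_X_pow_eq_monomial, phi_monomial]

lemma phi_C (F : ℕ → R) (F0 : F 0 = 1) (a : R) : phi F (Polynomial.C a) = a := by
  rw [← Polynomial.monomial_zero_left, phi_monomial, F0, mul_one]

lemma phi_C_mul (F : ℕ → R) (a : R) (p : Polynomial R) :
    phi F (Polynomial.C a * p) = a * phi F p := by
  rw [← Polynomial.smul_eq_C_mul, map_smul, smul_eq_mul]

def UU (r : R) (a : ℕ → R) (l : ℕ) : Polynomial R :=
  Polynomial.C r * ∑ i ∈ range l, Polynomial.C (2 * (-1) ^ (i + 1) * a (l - 1 - i)) * Polynomial.X ^ (i + 1)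

def VV (r : R) (a : ℕ → R) (l : ℕ) : Polynomial R :=
  Polynomial.C r * ∑ i ∈ range l, Polynomial.C (2 * a (l - 1 - i)) * Polynomial.X ^ (i + 1)

lemma phi_UU (F : ℕ → R) (F0 : F 0 = 1) (r : R) (a a' : ℕ → R)
    (ha : ∀ n, a' n = ∑ k ∈ range (n + 1), (-1) ^ k * F k * a (n - k)) (l : ℕ) :
    phi F (UU r a l) = 2 * r * (a' l - a l) := by
  rw [UU, phi_C_mul, map_sum, ha, Finset.sum_range_succ']
  have : ∑ i ∈ range l, phi F (Polynomial.C (2 * (-1) ^ (i + 1) * a (l - 1 - i)) * Polynomial.X ^ (i + 1))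
    = 2 * ∑ k ∈ range l, (-1) ^ (k + 1) * F (k + 1) * a (l - (k + 1)) := by
    rw [Finset.mul_sum]
    refine Finset.sum_congr rfl fun i _ => ?_
    rw [phi_CX, show l - (i + 1) = l - 1 - i by omega]; ring
  rw [this, F0]; simp; ring

lemma phi_VV (F : ℕ → R) (F0 : F 0 = 1) (r : R) (b b' : ℕ → R)
    (hb : ∀ n, b n = ∑ k ∈ range (n + 1), F k * b' (n - k)) (l : ℕ) :
    phi F (VV r b' l) = 2 * r * (b l - b' l) := by
  rw [VV, phi_C_mul, map_sum, hb, Finset.sum_range_succ']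
  have : ∑ i ∈ range l, phi F (Polynomial.C (2 * b' (l - 1 - i)) * Polynomial.X ^ (i + 1))
    = 2 * ∑ k ∈ range l, F (k + 1) * b' (l - (k + 1)) := by
    rw [Finset.mul_sum]
    refine Finset.sum_congr rfl fun i _ => ?_
    rw [phi_CX, show l - (i + 1) = l - 1 - i by omega]; ring
  rw [this, F0]; simp; ring

lemma phi_UV (F : ℕ → R) (r : R) (hr : 2 * (r * r) = 1) (a b' : ℕ → R) (l m : ℕ) :
    phi F (UU r a l * VV r b' m) = 2 * DD a b' F l m := by
  have h : UU r a l * VV r b' m = Polynomial.C (r * r) * ∑ i ∈ range l, ∑ j ∈ range m,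
     (Polynomial.C (2 * (-1) ^ (i + 1) * a (l - 1 - i) * (2 * b' (m - 1 - j))) * Polynomial.X ^ (i + j + 2)) := by
    have : ∑ i ∈ range l, ∑ j ∈ range m,
     (Polynomial.C (2 * (-1) ^ (i + 1) * a (l - 1 - i) * (2 * b' (m - 1 - j))) * Polynomial.X ^ (i + j + 2)) =
      (∑ i ∈ range l, Polynomial.C (2 * (-1) ^ (i + 1) * a (l - 1 - i)) * Polynomial.X ^ (i + 1)) *
      ∑ i ∈ range m, Polynomial.C (2 * b' (m - 1 - i)) * Polynomial.X ^ (i + 1) := by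
      rw [Finset.sum_mul_sum]
      refine Finset.sum_congr rfl fun i _ => Finset.sum_congr rfl fun j _ => ?_
      rw [Polynomial.C_mul (a := 2 * (-1) ^ (i + 1) * a (l - 1 - i))]; ring
    rw [this, UU, VV, Polynomial.C_mul]; ring
  rw [h, phi_C_mul, map_sum, DD, Finset.mul_sum, Finset.mul_sum]
  refine Finset.sum_congr rfl fun i _ => ?_
  rw [map_sum, Finset.mul_sum, Finset.mul_sum]
  refine Finset.sum_congr rfl fun j _ => ?_
  rw [phi_CX]
  linear_combination (2 * (-1) ^ (i + 1) * a (l - 1 - i) * b' (m - 1 - j) * F (i + j + 2)) * hr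

/-- the final algebraic cancellation -/
lemma final_alg {ι : Type*} [Fintype ι] (F : ℕ → R) (F0 : F 0 = 1) (T T' : R) (P P' W W' : ι → R)
    (A A' D : ι → ι → R) (U V : ι → Polynomial R)
    (hU : ∀ i, phi F (U i) = 2 * (W' i - W i)) (hV : ∀ i, phi F (V i) = 2 * (W i - W' i))
    (hUV : ∀ i j, phi F (U i * V j) = 2 * D i j)
    (hD : ∀ i j, D i j = A' i j - A i j - W' i * W' j - W i * W j + 2 * W i * W' j)
    (hskew : ∀ i j, A j i = - A i j)
    (hWP : ∑ k, W k * P k = 0) (hWP' : ∑ k, W' k * P' k = 0)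
    (hAP : ∀ i, ∑ k, A i k * P k = -(W i * T)) (hAP' : ∀ i, ∑ k, A' i k * P' k = -(W' i * T')) :
    phi F ((Polynomial.C T + ∑ k, U k * Polynomial.C (P k)) *
      (Polynomial.C T' + ∑ k, V k * Polynomial.C (P' k))) = T * T' := by
  have h : (Polynomial.C T + ∑ k, U k * Polynomial.C (P k)) *
      (Polynomial.C T' + ∑ k, V k * Polynomial.C (P' k)) =
      Polynomial.C (T * T') + ∑ k, Polynomial.C (P k * T') * U k + ∑ k, Polynomial.C (T * P' k) * V k
      + ∑ i, ∑ j, Polynomial.C (P i * P' j) * (U i * V j) := by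
    have h1 : ∑ i, ∑ j, Polynomial.C (P i * P' j) * (U i * V j) =
      (∑ k, U k * Polynomial.C (P k)) * ∑ k, V k * Polynomial.C (P' k) := by
      rw [Finset.sum_mul_sum]
      refine Finset.sum_congr rfl fun i _ => Finset.sum_congr rfl fun j _ => ?_
      rw [Polynomial.C_mul]; ring
    have h2 : ∑ k, Polynomial.C (P k * T') * U k = (∑ k, U k * Polynomial.C (P k)) * Polynomial.C T' := by
      rw [Finset.sum_mul]
      refine Finset.sum_congr rfl fun i _ => ?_
      rw [Polynomial.C_mul]; ring
    have h3 : ∑ k, Polynomial.C (T * P' k) * V k = Polynomial.C T * ∑ k, V k * Polynomial.C (P' k) := by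
      rw [Finset.mul_sum]
      refine Finset.sum_congr rfl fun i _ => ?_
      rw [Polynomial.C_mul]; ring
    rw [h1, h2, h3, Polynomial.C_mul]; ring
  rw [h]
  simp only [map_add, map_sum, phi_C F F0, phi_C_mul, hU, hV, hUV]
  have e1 : ∑ k, P k * T' * (2 * (W' k - W k)) = 2 * T' * ∑ k, W' k * P k := by
    have : ∑ k, P k * T' * (2 * (W' k - W k)) = 2 * T' * ∑ k, W' k * P k - 2 * T' * ∑ k, W k * P k := by
      rw [Finset.mul_sum, Finset.mul_sum, ← Finset.sum_sub_distrib]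
      exact Finset.sum_congr rfl fun i _ => by ring
    rw [this, hWP]; ring
  have e2 : ∑ k, T * P' k * (2 * (W k - W' k)) = 2 * T * ∑ k, W k * P' k := by
    have : ∑ k, T * P' k * (2 * (W k - W' k)) = 2 * T * ∑ k, W k * P' k - 2 * T * ∑ k, W' k * P' k := by
      rw [Finset.mul_sum, Finset.mul_sum, ← Finset.sum_sub_distrib]
      exact Finset.sum_congr rfl fun i _ => by ring
    rw [this, hWP']; ring
  have e3 : ∑ i, ∑ j, P i * P' j * (2 * D i j) =
     2 * ∑ i, P i * ∑ j, A' i j * P' j + 2 * ∑ j, P' j * ∑ i, A j i * P i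
     - 2 * (∑ i, W' i * P i) * (∑ j, W' j * P' j) - 2 * (∑ i, W i * P i) * (∑ j, W j * P' j)
     + 4 * (∑ i, W i * P i) * (∑ j, W' j * P' j) := by
    have s1 : ∑ j, P' j * ∑ i, A j i * P i = ∑ i, ∑ j, P' j * (A j i * P i) := by
      rw [Finset.sum_comm]
      exact Finset.sum_congr rfl fun i _ => by rw [Finset.mul_sum]
    rw [s1]
    simp only [mul_assoc, Finset.sum_mul_sum]
    simp only [Finset.mul_sum, ← Finset.sum_add_distrib, ← Finset.sum_sub_distrib]
    refine Finset.sum_congr rfl fun i _ => Finset.sum_congr rfl fun j _ => ?_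
    rw [hD, hskew i j]; ring
  have e4 : ∑ i, P i * ∑ j, A' i j * P' j = - (T' * ∑ k, W' k * P k) := by
    rw [Finset.mul_sum, ← Finset.sum_neg_distrib]
    exact Finset.sum_congr rfl fun i _ => by rw [hAP']; ring
  have e5 : ∑ i, P' i * ∑ j, A i j * P j = - (T * ∑ k, W k * P' k) := by
    rw [Finset.mul_sum, ← Finset.sum_neg_distrib]
    exact Finset.sum_congr rfl fun i _ => by rw [hAP]; ring
  rw [e1, e2, e3, e4, e5, hWP, hWP']; ring

end phisec

/-- `F n = s_n(t̃ - t̃')` -/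
def FFF (n : ℕ) : BRing2 := SS n (fun j => inL (tTilde j) - inR (tTilde j))

lemma inL_SS (n : ℕ) (c : ℕ → BRing) : inL (SS n c) = SS n (fun j => inL (c j)) :=
  SS_map (MvPolynomial.rename (R := ℂ) (Sum.inl : ℕ → ℕ ⊕ ℕ)) n c

lemma inR_SS (n : ℕ) (c : ℕ → BRing) : inR (SS n c) = SS n (fun j => inR (c j)) :=
  SS_map (MvPolynomial.rename (R := ℂ) (Sum.inr : ℕ → ℕ ⊕ ℕ)) n c

lemma inL_alg (z : ℂ) : inL (algebraMap ℂ BRing z) = algebraMap ℂ BRing2 z :=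
  (MvPolynomial.rename (R := ℂ) (Sum.inl : ℕ → ℕ ⊕ ℕ)).commutes z

lemma inR_alg (z : ℂ) : inR (algebraMap ℂ BRing z) = algebraMap ℂ BRing2 z :=
  (MvPolynomial.rename (R := ℂ) (Sum.inr : ℕ → ℕ ⊕ ℕ)).commutes z

lemma tShift_eq (c : ℕ → ℂ) (j : ℕ) : tShift c j = tTilde j + algebraMap ℂ BRing (c j) := rfl

lemma FFF_zero : FFF 0 = 1 := SS_zero_idx _

lemma FFF_left (c : ℕ → ℂ) (n : ℕ) : inL (sB n (tShift c)) =
    ∑ k ∈ range (n + 1), FFF k * inR (sB (n - k) (tShift c)) := by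
  have h := inL_SS n (tShift c)
  have h2 : (fun j => inL (tShift c j)) =
      fun j => (inL (tTilde j) - inR (tTilde j)) + inR (tShift c j) := by
    funext j
    rw [tShift_eq, map_add, map_add, inL_alg, inR_alg]; ring
  rw [h2, SS_add] at h
  refine h.trans (Finset.sum_congr rfl fun k _ => ?_)
  rw [← inR_SS]; rfl

lemma FFF_right (c : ℕ → ℂ) (n : ℕ) : inR (sB n (tShift c)) =
    ∑ k ∈ range (n + 1), (-1) ^ k * FFF k * inL (sB (n - k) (tShift c)) := by
  have h := inR_SS n (tShift c)
  have h2 : (fun j => inR (tShift c j)) =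
      fun j => (-1) ^ j * (inL (tTilde j) - inR (tTilde j)) + inL (tShift c j) := by
    funext j
    rw [tShift_eq, map_add, map_add, inL_alg, inR_alg]
    unfold tTilde
    split_ifs with hj
    · rw [Odd.neg_one_pow (Nat.odd_iff.2 hj)]; ring
    · simp
  rw [h2, SS_add] at h
  refine h.trans (Finset.sum_congr rfl fun k _ => ?_)
  rw [← inL_SS, SS_parity]; rfl

lemma FFF_conv (n : ℕ) : FFF n = ∑ k ∈ range (n + 1),
    inL (SS k tTilde) * inR (SS (n - k) (fun j => - tTilde j)) := by
  have h2 : (fun j => inL (tTilde j) - inR (tTilde j)) =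
      fun j => inL (tTilde j) + inR (- tTilde j) := by
    funext j; rw [map_neg]; ring
  rw [FFF, h2, SS_add]
  refine Finset.sum_congr rfl fun k _ => ?_
  rw [inL_SS, inR_SS]

lemma GG_const (c c' : ℕ → ℂ) (l m : ℕ) : ∃ z : ℂ,
    QQ (fun n => sB n (tShift c)) (fun n => sB n (tShift c')) l m +
    QQ (fun n => sB n (tShift c')) (fun n => sB n (tShift c)) m l +
    sB l (tShift c) * sB m (tShift c') = algebraMap ℂ BRing z := by
  refine ⟨(-1) ^ m * SS (l + m) (fun j => (-1) ^ j * c' j + c j), ?_⟩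
  have h := GG_eq (fun n => sB n (tShift c)) (fun n => sB n (tShift c')) l m
  refine h.trans ?_
  have h3 : algebraMap ℂ BRing (SS (l + m) (fun j => (-1) ^ j * c' j + c j)) =
    SS (l + m) (fun j => algebraMap ℂ BRing ((-1) ^ j * c' j + c j)) :=
    SS_map (Algebra.ofId ℂ BRing) _ _
  have h2 : (fun j => algebraMap ℂ BRing ((-1) ^ j * c' j + c j)) =
      fun j => (-1) ^ j * tShift c' j + tShift c j := by
    funext j
    rw [tShift_eq, tShift_eq, map_add, map_mul, map_pow, map_neg, map_one]
    unfold tTilde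
    split_ifs with hj
    · rw [Odd.neg_one_pow (Nat.odd_iff.2 hj)]; ring
    · simp
  rw [map_mul, map_pow, map_neg, map_one, h3, h2, SS_add]
  refine congrArg ((-1) ^ m * ·) (Finset.sum_congr rfl fun k _ => ?_)
  rw [SS_parity]; rfl

end

noncomputable section
open Finset

lemma rho_const {m : ℕ} (lam : Fin m → ℕ) (c : Fin m → ℕ → ℂ) (b : Fin m → ℂ) (i j : Fin m) :
    ∃ z : ℂ, rhoMatrixEven lam c b i j =
      rhoB (lam i) (lam j) (tShift (c i)) (tShift (c j)) (b i) (b j) + algebraMap ℂ BRing z := by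
  have hr := sqrt2_sq_alg (R := BRing)
  simp only [rhoMatrixEven, skewOf, Matrix.of_apply]
  split_ifs with h1 h2
  · exact ⟨0, by rw [map_zero, add_zero]⟩
  · obtain ⟨K, hK⟩ := GG_const (c i) (c j) (lam i) (lam j)
    refine ⟨-(K - 2 * (b i * b j)), ?_⟩
    rw [rhoB_eq, rhoB_eq, map_neg, map_sub, map_mul, map_mul, map_ofNat]
    linear_combination (-1 : BRing) * hK - sB (lam i) (tShift (c i)) * sB (lam j) (tShift (c j)) * hr
  · have : i = j := by omega
    subst this
    obtain ⟨K, hK⟩ := GG_const (c i) (c i) (lam i) (lam i)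
    refine ⟨-(sqrt2⁻¹ * sqrt2⁻¹ * K - b i * b i), ?_⟩
    rw [rhoB_eq, map_neg, map_sub, map_mul, map_mul, map_mul]
    linear_combination (-(algebraMap ℂ BRing sqrt2⁻¹ * algebraMap ℂ BRing sqrt2⁻¹)) * hK +
      QQ (fun n => sB n (tShift (c i))) (fun n => sB n (tShift (c i))) (lam i) (lam i) * hr

lemma D_eq {m : ℕ} (lam : Fin m → ℕ) (c : Fin m → ℕ → ℂ) (b : Fin m → ℂ) (i j : Fin m) :
    DD (fun n => inL (sB n (tShift (c i)))) (fun n => inR (sB n (tShift (c j)))) FFF (lam i) (lam j) =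
      inR (rhoMatrixEven lam c b i j) - inL (rhoMatrixEven lam c b i j)
      - inR (rho1B (lam i) (tShift (c i)) (b i)) * inR (rho1B (lam j) (tShift (c j)) (b j))
      - inL (rho1B (lam i) (tShift (c i)) (b i)) * inL (rho1B (lam j) (tShift (c j)) (b j))
      + 2 * inL (rho1B (lam i) (tShift (c i)) (b i)) * inR (rho1B (lam j) (tShift (c j)) (b j)) := by
  obtain ⟨z, hz⟩ := rho_const lam c b i j
  have h := DD_eq (fun n => inL (sB n (tShift (c i)))) (fun n => inR (sB n (tShift (c i))))
    (fun n => inL (sB n (tShift (c j)))) (fun n => inR (sB n (tShift (c j)))) FFF FFF_zero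
    (FFF_right (c i)) (FFF_left (c j)) (lam i) (lam j)
  rw [← QQ_map, ← QQ_map] at h
  rw [h, hz, rhoB_eq, rho1B_eq, rho1B_eq]
  simp only [map_add, map_mul, map_sub, inL_alg, inR_alg]
  have hr := sqrt2_sq_alg (R := BRing2)
  generalize algebraMap ℂ BRing2 sqrt2⁻¹ = r at *
  generalize algebraMap ℂ BRing2 z = z at *
  generalize algebraMap ℂ BRing2 (b i) = β at *
  generalize algebraMap ℂ BRing2 (b j) = β' at *
  generalize inL (QQ (R := BRing) _ _ _ _) = q at *
  generalize inR (QQ (R := BRing) _ _ _ _) = q' at *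
  generalize inL (sB (lam i) (tShift (c i))) = a at *
  generalize inR (sB (lam i) (tShift (c i))) = a' at *
  generalize inL (sB (lam j) (tShift (c j))) = d at *
  generalize inR (sB (lam j) (tShift (c j))) = d' at *
  linear_combination (a * d - a * d') * hr

lemma uu_L (l : ℕ) (c : ℕ → ℂ) : (uu Polynomial.X l c).map inL =
    UU (algebraMap ℂ BRing2 sqrt2⁻¹) (fun n => inL (sB n (tShift c))) l := by
  rw [uu_eq, UU, ← C_algebraMap, Polynomial.map_mul, Polynomial.map_C, inL_alg, Polynomial.map_sum]
  refine congrArg (_ * ·) (Finset.sum_congr rfl fun i _ => ?_)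
  rw [neg_pow]
  simp only [Polynomial.map_mul, Polynomial.map_pow, Polynomial.map_neg,
    Polynomial.map_X, Polynomial.map_C, Polynomial.map_ofNat, Polynomial.C_mul, Polynomial.C_pow,
    Polynomial.C_neg, Polynomial.C_1, Polynomial.C_ofNat]
  ring

lemma uu_R (l : ℕ) (c : ℕ → ℂ) : (uu (ng Polynomial.X) l c).map inR =
    VV (algebraMap ℂ BRing2 sqrt2⁻¹) (fun n => inR (sB n (tShift c))) l := by
  rw [uu_eq, VV, ← C_algebraMap, Polynomial.map_mul, Polynomial.map_C, inR_alg, Polynomial.map_sum]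
  refine congrArg (_ * ·) (Finset.sum_congr rfl fun i _ => ?_)
  rw [ng, neg_neg]
  simp only [Polynomial.map_mul, Polynomial.map_pow, 
    Polynomial.map_X, Polynomial.map_C, Polynomial.map_ofNat, Polynomial.C_mul, 
    Polynomial.C_ofNat]
  ring

lemma coeff_conv (k k' : ℕ) (z : BRing2) :
    (Function.support fun m : ℤ => inL (sTildeZ (m + k)) * inR (sTildeNegZ (-m + k')) * z).Finite ∧
    ∑ᶠ m : ℤ, inL (sTildeZ (m + k)) * inR (sTildeNegZ (-m + k')) * z = z * FFF (k + k') := by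
  have hs : (Function.support fun m : ℤ => inL (sTildeZ (m + k)) * inR (sTildeNegZ (-m + k')) * z) ⊆
      ((range (k + k' + 1)).image (fun i : ℕ => (i : ℤ) - k) : Finset ℤ) := by
    intro m hm
    have h1 : 0 ≤ m + k := by
      by_contra h
      apply hm
      simp only [sTildeZ, if_neg h, map_zero, zero_mul]
    have h2 : 0 ≤ -m + k' := by
      by_contra h
      apply hm
      simp only [sTildeNegZ, if_neg h, map_zero, zero_mul, mul_zero]
    simp only [Finset.coe_image, Set.mem_image, Finset.mem_coe, Finset.mem_range]
    exact ⟨(m + k).toNat, by omega, by omega⟩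
  refine ⟨Set.Finite.subset (Finset.finite_toSet _) hs, ?_⟩
  rw [finsum_eq_sum_of_support_subset _ hs, Finset.sum_image (by intro a _ b _ h; simpa using h),
    FFF_conv, Finset.mul_sum]
  refine Finset.sum_congr rfl fun i hi => ?_
  rw [Finset.mem_range] at hi
  have e1 : sTildeZ ((i : ℤ) - k + k) = SS i tTilde := by
    rw [sub_add_cancel, sTildeZ, if_pos (by omega)]; simp [SS]
  have e2 : sTildeNegZ (-((i : ℤ) - k) + k') = SS (k + k' - i) (fun j => - tTilde j) := by
    rw [sTildeNegZ, if_pos (by omega), show (-((i : ℤ) - k) + k').toNat = k + k' - i by omega]; rfl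
  rw [e1, e2]; ring

lemma bkp_sum (p q : Polynomial BRing) :
    ∑ᶠ m : ℤ, inL (∑ᶠ k : ℕ, sTildeZ (m + k) * p.coeff k) *
      inR (∑ᶠ k : ℕ, sTildeNegZ (-m + k) * q.coeff k) = phi FFF (p.map inL * q.map inR) := by
  have hf : ∀ (p : Polynomial BRing) (f : ℕ → BRing),
      ∑ᶠ k : ℕ, f k * p.coeff k = ∑ k ∈ p.support, f k * p.coeff k := by
    intro p f
    refine finsum_eq_sum_of_support_subset _ fun k hk => ?_
    rw [Finset.mem_coe, Polynomial.mem_support_iff]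
    intro h
    apply hk
    simp only [h, mul_zero]
  have h1 : ∀ m : ℤ, inL (∑ᶠ k : ℕ, sTildeZ (m + k) * p.coeff k) *
      inR (∑ᶠ k : ℕ, sTildeNegZ (-m + k) * q.coeff k) =
      ∑ x ∈ p.support ×ˢ q.support, inL (sTildeZ (m + x.1)) * inR (sTildeNegZ (-m + x.2)) *
        (inL (p.coeff x.1) * inR (q.coeff x.2)) := by
    intro m
    rw [hf, hf, map_sum, map_sum, Finset.sum_mul_sum, Finset.sum_product]
    refine Finset.sum_congr rfl fun i _ => Finset.sum_congr rfl fun j _ => ?_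
    rw [map_mul, map_mul]; ring
  simp_rw [h1]
  rw [finsum_sum_comm (p.support ×ˢ q.support)
    (fun (m : ℤ) (x : ℕ × ℕ) => inL (sTildeZ (m + x.1)) * inR (sTildeNegZ (-m + x.2)) *
        (inL (p.coeff x.1) * inR (q.coeff x.2))) (fun x _ => (coeff_conv x.1 x.2 _).1)]
  have h2 : p.map inL * q.map inR = ∑ x ∈ p.support ×ˢ q.support,
      Polynomial.monomial (x.1 + x.2) (inL (p.coeff x.1) * inR (q.coeff x.2)) := by
    conv_lhs => rw [p.as_sum_support, q.as_sum_support]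
    rw [Polynomial.map_sum, Polynomial.map_sum, Finset.sum_mul_sum, Finset.sum_product]
    refine Finset.sum_congr rfl fun i _ => Finset.sum_congr rfl fun j _ => ?_
    rw [Polynomial.map_monomial, Polynomial.map_monomial, Polynomial.monomial_mul_monomial]
  rw [h2, map_sum]
  refine Finset.sum_congr rfl fun x _ => ?_
  rw [(coeff_conv x.1 x.2 _).2, phi_monomial]

lemma phi_UU_rho (l : ℕ) (c : ℕ → ℂ) (b : ℂ) :
    phi FFF (UU (algebraMap ℂ BRing2 sqrt2⁻¹) (fun n => inL (sB n (tShift c))) l)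
      = 2 * (inR (rho1B l (tShift c) b) - inL (rho1B l (tShift c) b)) := by
  have h := phi_UU FFF FFF_zero (algebraMap ℂ BRing2 sqrt2⁻¹) (fun n => inL (sB n (tShift c)))
    (fun n => inR (sB n (tShift c))) (FFF_right c) l
  rw [h, rho1B_eq, map_add, map_add, map_mul, map_mul, inL_alg, inL_alg, inR_alg, inR_alg]
  ring

lemma phi_VV_rho (l : ℕ) (c : ℕ → ℂ) (b : ℂ) :
    phi FFF (VV (algebraMap ℂ BRing2 sqrt2⁻¹) (fun n => inR (sB n (tShift c))) l)
      = 2 * (inL (rho1B l (tShift c) b) - inR (rho1B l (tShift c) b)) := by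
  have h := phi_VV FFF FFF_zero (algebraMap ℂ BRing2 sqrt2⁻¹) (fun n => inL (sB n (tShift c)))
    (fun n => inR (sB n (tShift c))) (FFF_left c) l
  rw [h, rho1B_eq, map_add, map_add, map_mul, map_mul, inL_alg, inL_alg, inR_alg, inR_alg]
  ring

lemma main_aux (n : ℕ) (lam : Fin (2 * n) → ℕ)
    (c : Fin (2 * n) → ℕ → ℂ) (b : Fin (2 * n) → ℂ) :
    SatisfiesBKP (pfaffian (rhoMatrixEven lam c b)) := by
  obtain ⟨P, hWP, hAP, hP⟩ := exists_P (rhoMatrixEven lam c b)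
    (fun i j => rho_skew lam c b i j) (fun i => rho1B (lam i) (tShift (c i)) (b i))
  have hsh : ∀ x : Polynomial BRing, sh x (pfaffian (rhoMatrixEven lam c b)) =
      Polynomial.C (pfaffian (rhoMatrixEven lam c b)) +
        ∑ k, uu x (lam k) (c k) * Polynomial.C (P k) := by
    intro x
    have h := hP (Polynomial BRing) Polynomial.C (fun i => uu x (lam i) (c i))
    rw [← h, ← sh_matrix]
    exact pfaffian_map (sh x).toRingHom _
  have hr := sqrt2_sq_alg (R := BRing2)
  have hU := fun i => phi_UU_rho (lam i) (c i) (b i)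
  have hV := fun i => phi_VV_rho (lam i) (c i) (b i)
  have hsk : ∀ i j, inL (rhoMatrixEven lam c b j i) = - inL (rhoMatrixEven lam c b i j) := by
    intro i j
    rw [rho_skew lam c b i j, map_neg]
  have w1 : ∑ k, inL (rho1B (lam k) (tShift (c k)) (b k)) * inL (P k) = 0 := by
    have := congrArg inL hWP
    rw [map_sum, map_zero] at this
    rw [← this]
    exact Finset.sum_congr rfl fun k _ => (map_mul inL _ _).symm
  have w2 : ∑ k, inR (rho1B (lam k) (tShift (c k)) (b k)) * inR (P k) = 0 := by
    have := congrArg inR hWP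
    rw [map_sum, map_zero] at this
    rw [← this]
    exact Finset.sum_congr rfl fun k _ => (map_mul inR _ _).symm
  have a1 : ∀ i, ∑ k, inL (rhoMatrixEven lam c b i k) * inL (P k) =
      -(inL (rho1B (lam i) (tShift (c i)) (b i)) * inL (pfaffian (rhoMatrixEven lam c b))) := by
    intro i
    have := congrArg inL (hAP i)
    rw [map_sum, map_neg, map_mul] at this
    rw [← this]
    exact Finset.sum_congr rfl fun k _ => (map_mul inL _ _).symm
  have a2 : ∀ i, ∑ k, inR (rhoMatrixEven lam c b i k) * inR (P k) =
      -(inR (rho1B (lam i) (tShift (c i)) (b i)) * inR (pfaffian (rhoMatrixEven lam c b))) := by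
    intro i
    have := congrArg inR (hAP i)
    rw [map_sum, map_neg, map_mul] at this
    rw [← this]
    exact Finset.sum_congr rfl fun k _ => (map_mul inR _ _).symm
  have key := final_alg FFF FFF_zero (inL (pfaffian (rhoMatrixEven lam c b)))
    (inR (pfaffian (rhoMatrixEven lam c b))) (fun k => inL (P k)) (fun k => inR (P k))
    (fun i => inL (rho1B (lam i) (tShift (c i)) (b i)))
    (fun i => inR (rho1B (lam i) (tShift (c i)) (b i)))
    (fun i j => inL (rhoMatrixEven lam c b i j)) (fun i j => inR (rhoMatrixEven lam c b i j))
    (fun i j => DD (fun n => inL (sB n (tShift (c i)))) (fun n => inR (sB n (tShift (c j))))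
      FFF (lam i) (lam j))
    (fun i => UU (algebraMap ℂ BRing2 sqrt2⁻¹) (fun n => inL (sB n (tShift (c i)))) (lam i))
    (fun i => VV (algebraMap ℂ BRing2 sqrt2⁻¹) (fun n => inR (sB n (tShift (c i)))) (lam i))
    hU hV (fun i j => phi_UV _ _ hr _ _ _ _) (fun i j => D_eq lam c b i j) hsk w1 w2 a1 a2
  unfold SatisfiesBKP leftCoeff rightCoeff
  rw [bkp_sum, shiftMinus_eq, shiftPlus_eq, hsh, hsh]
  simp only [Polynomial.map_add, Polynomial.map_sum, Polynomial.map_mul, Polynomial.map_C, uu_L, uu_R]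
  exact key

end


noncomputable section

/-- For every `n ≥ 0`, integers `λ_1 > ⋯ > λ_{2n} ≥ 0`, sequences
`c_1, …, c_{2n}` of complex numbers and `b_1, …, b_{2n} ∈ ℂ`, the polynomial
`τ₀ = Pf( ρ_{λ_i,λ_j}(t̃+c_i, t̃+c_j; b_i, b_j) )_{1≤i,j≤2n}` satisfies the BKP bilinear
identity (the bosonic form of the DKP hierarchy on the even sector `V₀`). -/
theorem polynomial_tau_DKP_even (n : ℕ) (lam : Fin (2 * n) → ℕ) (hlam : StrictAnti lam)
    (c : Fin (2 * n) → ℕ → ℂ) (b : Fin (2 * n) → ℂ) :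
    SatisfiesBKP (pfaffian (rhoMatrixEven lam c b)) := by
  exact main_aux n lam c b

end
end
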